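/- Let n ≥ 371. Then there exists λ₀ = λ₀(n) > 0 such that for every λ > λ₀ the following holds: if c_1, …, c_n is a packing of n unit disks in E² for which vol_2(⋃_{i=1}^n (c_i + (1+λ)B²)) is minimal over all packings of n unit disks in E², then {c_1, …, c_n} is not a subfamily of the densest lattice packing of unit disks, i.e., there is no isometry φ of E² such that {φ(c_1), …, φ(c_n)} is contained in the hexagonal lattice {a·(2,0) + b·(1,√3) : a, b ∈ ℤ}. -/

import Mathlib

open MeasureTheory Metric

/-- The hexagonal lattice `{a·(2,0) + b·(1,√3) : a, b ∈ ℤ}` of centers of the densest lattice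
packing of unit disks in `E²`. -/
noncomputable def hexLattice : Set (EuclideanSpace ℝ (Fin 2)) :=
  {v | ∃ a b : ℤ,
    v = a • (WithLp.equiv 2 (Fin 2 → ℝ)).symm ![(2 : ℝ), 0] +
        b • (WithLp.equiv 2 (Fin 2 → ℝ)).symm ![(1 : ℝ), Real.sqrt 3]}

abbrev Pl := EuclideanSpace ℝ (Fin 2)

noncomputable def eqPl : Pl ≃ᵐ ℝ × ℝ :=
  (MeasurableEquiv.toLp 2 (Fin 2 → ℝ)).symm.trans MeasurableEquiv.finTwoArrow

theorem eqPl_mp : MeasurePreserving eqPl volume volume :=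
  (EuclideanSpace.volume_preserving_symm_measurableEquiv_toLp (Fin 2)).trans
    (volume_preserving_finTwoArrow ℝ)

theorem eqPl_apply (x : Pl) : eqPl x = (x 0, x 1) := rfl

theorem eqPl_symm_apply (p : ℝ × ℝ) : eqPl.symm p = !₂[p.1, p.2] := by
  rw [MeasurableEquiv.symm_apply_eq, eqPl_apply]; simp

noncomputable def pol (r θ : ℝ) : Pl := !₂[r * Real.cos θ, r * Real.sin θ]

theorem volume_polar (A : Set Pl) (hA : MeasurableSet A) :
    volume A = ∫⁻ p in Set.Ioi (0:ℝ) ×ˢ Set.Ioo (-Real.pi) Real.pi,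
      ENNReal.ofReal p.1 * A.indicator 1 (pol p.1 p.2) := by
  have h1 : volume A = volume (eqPl.symm ⁻¹' A) :=
    (eqPl_mp.symm.measure_preimage_equiv A).symm
  have h2 : volume (eqPl.symm ⁻¹' A) = ∫⁻ p, (eqPl.symm ⁻¹' A).indicator 1 p := by
    rw [lintegral_indicator_one (eqPl.symm.measurable hA)]
  rw [h1, h2, ← lintegral_comp_polarCoord_symm, polarCoord_target]
  refine lintegral_congr fun p => ?_
  rw [polarCoord_symm_apply, smul_eq_mul]
  congr 1
theorem inner_radial (a : ℝ) (ha : 0 ≤ a) :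
    ∫⁻ r in Set.Ioi (0:ℝ), ENNReal.ofReal r * (Set.Iic a).indicator 1 r
      = ENNReal.ofReal (a ^ 2 / 2) := by
  have h : ∀ r, ENNReal.ofReal r * (Set.Iic a).indicator 1 r
      = (Set.Iic a).indicator (fun r => ENNReal.ofReal r) r := by
    intro r; by_cases hr : r ∈ Set.Iic a <;> simp [Set.indicator, hr]
  simp_rw [h]
  rw [lintegral_indicator measurableSet_Iic, Measure.restrict_restrict measurableSet_Iic]
  have : Set.Iic a ∩ Set.Ioi 0 = Set.Ioc 0 a := by ext; simp [and_comm]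
  rw [this, ← ofReal_integral_eq_lintegral_ofReal]
  · rw [← intervalIntegral.integral_of_le ha, integral_id]; simp
  · exact (continuous_id.integrableOn_Icc (a := 0) (b := a)).mono_set Set.Ioc_subset_Icc_self
  · filter_upwards [ae_restrict_mem measurableSet_Ioc] with x hx using hx.1.le

theorem radial_area (ρ : ℝ → ℝ) (hρ : Continuous ρ) (h0 : ∀ θ, 0 ≤ ρ θ) :
    ∫⁻ p in Set.Ioi (0:ℝ) ×ˢ Set.Ioo (-Real.pi) Real.pi,
      ENNReal.ofReal p.1 * {p : ℝ × ℝ | p.1 ≤ ρ p.2}.indicator 1 p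
      = ENNReal.ofReal (∫ θ in (-Real.pi)..Real.pi, ρ θ ^ 2 / 2) := by
  have hm : MeasurableSet {p : ℝ × ℝ | p.1 ≤ ρ p.2} :=
    measurableSet_le measurable_fst (hρ.measurable.comp measurable_snd)
  rw [Measure.volume_eq_prod, ← Measure.prod_restrict, lintegral_prod_symm]
  · have : ∀ y, ∫⁻ x in Set.Ioi (0:ℝ), ENNReal.ofReal (x, y).1 *
        {p : ℝ × ℝ | p.1 ≤ ρ p.2}.indicator 1 (x, y) = ENNReal.ofReal (ρ y ^ 2 / 2) := by
      intro y
      rw [← inner_radial (ρ y) (h0 y)]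
      rfl
    simp_rw [this]
    rw [← ofReal_integral_eq_lintegral_ofReal]
    · rw [intervalIntegral.integral_of_le (by linarith [Real.pi_pos]), integral_Ioc_eq_integral_Ioo]
    · exact ((by fun_prop : Continuous fun θ => ρ θ ^ 2 / 2).integrableOn_Icc
        (a := -Real.pi) (b := Real.pi)).mono_set Set.Ioo_subset_Icc_self
    · exact Filter.Eventually.of_forall fun θ => by positivity
  · refine Measurable.aemeasurable ?_
    exact (measurable_fst.ennreal_ofReal).mul (measurable_one.indicator hm)

theorem vol_le_of_radial (A : Set Pl) (hA : MeasurableSet A) (ρ : ℝ → ℝ) (hρ : Continuous ρ)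
    (h0 : ∀ θ, 0 ≤ ρ θ) (h : ∀ r θ, 0 < r → pol r θ ∈ A → r ≤ ρ θ) :
    volume A ≤ ENNReal.ofReal (∫ θ in (-Real.pi)..Real.pi, ρ θ ^ 2 / 2) := by
  rw [volume_polar A hA, ← radial_area ρ hρ h0]
  refine setLIntegral_mono' (measurableSet_Ioi.prod measurableSet_Ioo) fun p hp => ?_
  gcongr
  by_cases hpA : pol p.1 p.2 ∈ A
  · have := h p.1 p.2 hp.1 hpA
    simp [Set.indicator, hpA, this]
  · simp [Set.indicator, hpA]

theorem le_vol_of_radial (A : Set Pl) (hA : MeasurableSet A) (ρ : ℝ → ℝ) (hρ : Continuous ρ)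
    (h0 : ∀ θ, 0 ≤ ρ θ) (h : ∀ r θ, 0 < r → r ≤ ρ θ → pol r θ ∈ A) :
    ENNReal.ofReal (∫ θ in (-Real.pi)..Real.pi, ρ θ ^ 2 / 2) ≤ volume A := by
  rw [volume_polar A hA, ← radial_area ρ hρ h0]
  refine setLIntegral_mono' (measurableSet_Ioi.prod measurableSet_Ioo) fun p hp => ?_
  gcongr
  by_cases hpA : p.1 ≤ ρ p.2
  · have := h p.1 p.2 hp.1 hpA
    simp [Set.indicator, hpA, this]
  · simp [Set.indicator, hpA]

noncomputable def pr (x : Pl) (θ : ℝ) : ℝ := x 0 * Real.cos θ + x 1 * Real.sin θ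

theorem pr_cont (x : Pl) : Continuous (pr x) := by unfold pr; fun_prop

theorem pr_add (x y : Pl) (θ : ℝ) : pr (x + y) θ = pr x θ + pr y θ := by simp [pr]; ring
theorem pr_sub (x y : Pl) (θ : ℝ) : pr (x - y) θ = pr x θ - pr y θ := by simp [pr]; ring
theorem pr_smul (t : ℝ) (y : Pl) (θ : ℝ) : pr (t • y) θ = t * pr y θ := by simp [pr]; ring

theorem nsq (x : Pl) : ‖x‖ ^ 2 = x 0 ^ 2 + x 1 ^ 2 := by
  rw [EuclideanSpace.norm_sq_eq]; simp

theorem pr_sq_le (x : Pl) (θ : ℝ) : pr x θ ^ 2 ≤ ‖x‖ ^ 2 := by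
  rw [nsq, pr]
  nlinarith [sq_nonneg (x 0 * Real.sin θ - x 1 * Real.cos θ), Real.sin_sq_add_cos_sq θ]

theorem pr_le (x : Pl) (θ : ℝ) : pr x θ ≤ ‖x‖ := by
  exact le_of_sq_le_sq₀ (pr_sq_le x θ) (norm_nonneg _)
where le_of_sq_le_sq₀ {a b : ℝ} (h : a ^ 2 ≤ b ^ 2) (hb : 0 ≤ b) : a ≤ b := abs_le_of_sq_le_sq' h hb |>.2

theorem pr_ge (x : Pl) (θ : ℝ) : -‖x‖ ≤ pr x θ := (abs_le_of_sq_le_sq' (pr_sq_le x θ) (norm_nonneg _)).1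

noncomputable def Hs {ι : Type} (c : ι → Pl) (θ : ℝ) : ℝ := ⨆ i, pr (c i) θ

section
variable {ι : Type} [Fintype ι] [Nonempty ι]

theorem le_Hs (c : ι → Pl) (θ : ℝ) (i : ι) : pr (c i) θ ≤ Hs c θ :=
  le_ciSup (f := fun i => pr (c i) θ) (Set.finite_range _).bddAbove i

theorem Hs_le (c : ι → Pl) (θ : ℝ) (a : ℝ) (h : ∀ i, pr (c i) θ ≤ a) : Hs c θ ≤ a := ciSup_le h

theorem exists_Hs (c : ι → Pl) (θ : ℝ) : ∃ i, pr (c i) θ = Hs c θ := exists_eq_ciSup_of_finite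

theorem Hs_cont (c : ι → Pl) : Continuous (Hs c) := by
  have : Hs c = fun θ => Finset.univ.sup' Finset.univ_nonempty (fun i => pr (c i) θ) := by
    ext θ; rw [Finset.sup'_univ_eq_ciSup]; rfl
  rw [this]
  exact Continuous.finset_sup'_apply _ fun i _ => pr_cont (c i)

noncomputable def Wd (c : ι → Pl) : ℝ := ∫ θ in (-Real.pi)..Real.pi, Hs c θ

theorem meas_union (c : ι → Pl) (R : ℝ) : MeasurableSet (⋃ i, closedBall (c i) R) :=
  MeasurableSet.iUnion fun _ => isClosed_closedBall.measurableSet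

theorem pol_sub_norm (r θ : ℝ) (x : Pl) :
    ‖pol r θ - x‖ ^ 2 = (r - pr x θ) ^ 2 + (‖x‖ ^ 2 - pr x θ ^ 2) := by
  rw [nsq, nsq]
  simp only [pol, pr, PiLp.sub_apply]
  simp
  have := Real.sin_sq_add_cos_sq θ
  have h2 : Real.sin θ ^ 2 = 1 - Real.cos θ ^ 2 := by linarith
  ring_nf
  rw [h2]; ring

theorem vol_upper (c : ι → Pl) (D R : ℝ) (hD : ∀ i, ‖c i‖ ≤ D) (hDR : D ≤ R) :
    volume (⋃ i, closedBall (c i) R) ≤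
      ENNReal.ofReal (∫ θ in (-Real.pi)..Real.pi, (R + Hs c θ) ^ 2 / 2) := by
  refine vol_le_of_radial _ (meas_union c R) _ (continuous_const.add (Hs_cont c)) ?_ ?_
  · intro θ
    have := Classical.arbitrary ι
    linarith [le_Hs c θ this, pr_ge (c this) θ, hD this]
  · intro r θ hr hmem
    obtain ⟨i, hi⟩ := Set.mem_iUnion.1 hmem
    rw [mem_closedBall, dist_eq_norm] at hi
    have h1 := pol_sub_norm r θ (c i)
    have h2 := pr_sq_le (c i) θ
    have h3 : (r - pr (c i) θ) ^ 2 ≤ R ^ 2 := by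
      have : ‖pol r θ - c i‖ ^ 2 ≤ R ^ 2 := by gcongr
      linarith
    have hR : 0 ≤ R := (norm_nonneg _).trans hi
    have := (abs_le_of_sq_le_sq' h3 hR).2
    linarith [le_Hs c θ i]

theorem vol_lower (c : ι → Pl) (D R : ℝ) (hD : ∀ i, ‖c i‖ ≤ D) (hDR : 2 * D ≤ R) (hR : 0 < R) :
    ENNReal.ofReal (∫ θ in (-Real.pi)..Real.pi, (R + Hs c θ - D ^ 2 / R) ^ 2 / 2) ≤
     volume (⋃ i, closedBall (c i) R) := by
  have hD0 : 0 ≤ D := (norm_nonneg _).trans (hD (Classical.arbitrary ι))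
  have hDR' : D ^ 2 / R ≤ D / 2 := by rw [div_le_iff₀ hR]; nlinarith
  have hd0 : 0 ≤ D ^ 2 / R := by positivity
  have hdR : D ^ 2 / R * R = D ^ 2 := by field_simp
  refine le_vol_of_radial _ (meas_union c R) _ (by have := Hs_cont c; fun_prop) ?_ ?_
  · intro θ
    have := Classical.arbitrary ι
    linarith [le_Hs c θ this, pr_ge (c this) θ, hD this]
  · intro r θ hr hle
    obtain ⟨i, hi⟩ := exists_Hs c θ
    refine Set.mem_iUnion.2 ⟨i, ?_⟩
    rw [mem_closedBall, dist_eq_norm]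
    refine (abs_le_of_sq_le_sq' ?_ hR.le).2
    rw [pol_sub_norm, hi]
    have h1 : ‖c i‖ ^ 2 ≤ D ^ 2 := by have := hD i; gcongr
    have hb : Hs c θ ≤ D := by rw [← hi]; exact (pr_le _ _).trans (hD i)
    generalize D ^ 2 / R = e at *
    generalize Hs c θ = H at *
    by_cases hrH : r ≤ H
    · have : 0 ≤ r * (2 * H - r) := by nlinarith
      nlinarith
    · nlinarith

theorem vol_compare (c c' : ι → Pl) (h : Wd c' < Wd c) :
    ∃ R0 : ℝ, ∀ R, R0 < R →
      volume (⋃ i, closedBall (c' i) R) < volume (⋃ i, closedBall (c i) R) := by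
  obtain ⟨D, hD⟩ : ∃ D, ∀ i, ‖c i‖ ≤ D :=
    ⟨_, fun i => le_ciSup (f := fun i => ‖c i‖) (Set.finite_range _).bddAbove i⟩
  obtain ⟨D', hD'⟩ : ∃ D, ∀ i, ‖c' i‖ ≤ D :=
    ⟨_, fun i => le_ciSup (f := fun i => ‖c' i‖) (Set.finite_range _).bddAbove i⟩
  have hD0 : 0 ≤ D := (norm_nonneg _).trans (hD (Classical.arbitrary ι))
  set K := ∫ θ in (-Real.pi)..Real.pi, Hs c' θ ^ 2 / 2 with hK
  have hK0 : 0 ≤ K := intervalIntegral.integral_nonneg (by linarith [Real.pi_pos])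
    fun θ _ => by positivity
  refine ⟨2 * D + |D'| + 1 + (K + 4 * D ^ 2 * Real.pi) / (Wd c - Wd c'), fun R hR => ?_⟩
  have hw : 0 < Wd c - Wd c' := by linarith
  have hpi := Real.pi_pos
  have hq : 0 ≤ (K + 4 * D ^ 2 * Real.pi) / (Wd c - Wd c') := by positivity
  have hDa := le_abs_self D'
  have hDb := abs_nonneg D'
  have hRpos : 0 < R := by linarith
  refine (vol_upper c' D' R hD' (by linarith)).trans_lt (lt_of_lt_of_le ?_
    (vol_lower c D R hD (by linarith) hRpos))
  have hc := Hs_cont c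
  have hc' := Hs_cont c'
  have e1 : (∫ θ in (-Real.pi)..Real.pi, (R + Hs c' θ) ^ 2 / 2)
      = Real.pi * R ^ 2 + R * Wd c' + K := by
    have : ∀ θ, (R + Hs c' θ) ^ 2 / 2 = (R ^ 2 / 2 + R * Hs c' θ) + Hs c' θ ^ 2 / 2 := by
      intro θ; ring
    simp_rw [this]
    rw [intervalIntegral.integral_add, intervalIntegral.integral_add,
      intervalIntegral.integral_const, intervalIntegral.integral_const_mul, ← hK, Wd]
    · simp; ring
    all_goals exact (by fun_prop : Continuous _).intervalIntegrable _ _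
  have e2 : Real.pi * R ^ 2 + R * Wd c - 4 * D ^ 2 * Real.pi ≤
      (∫ θ in (-Real.pi)..Real.pi, (R + Hs c θ - D ^ 2 / R) ^ 2 / 2) := by
    have l : (∫ θ in (-Real.pi)..Real.pi, ((R ^ 2 / 2 - 2 * D ^ 2) + R * Hs c θ))
        = Real.pi * R ^ 2 + R * Wd c - 4 * D ^ 2 * Real.pi := by
      rw [intervalIntegral.integral_add, 
        intervalIntegral.integral_const, intervalIntegral.integral_const_mul, Wd]
      · simp; ring
      all_goals exact (by fun_prop : Continuous _).intervalIntegrable _ _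
    rw [← l]
    refine intervalIntegral.integral_mono_on (by linarith) ?_ ?_ fun θ _ => ?_
    iterate 2 exact (by fun_prop : Continuous _).intervalIntegrable _ _
    have hdR : D ^ 2 / R * R = D ^ 2 := by field_simp
    have hd0 : 0 ≤ D ^ 2 / R := by positivity
    have hb : Hs c θ ≤ D := Hs_le c θ D fun i => (pr_le _ _).trans (hD i)
    have hb' : -D ≤ Hs c θ := by
      have i := Classical.arbitrary ι
      linarith [le_Hs c θ i, pr_ge (c i) θ, hD i]
    have hDR' : D ^ 2 / R ≤ D / 2 := by rw [div_le_iff₀ hRpos]; nlinarith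
    generalize D ^ 2 / R = e at *
    generalize Hs c θ = H at *
    nlinarith [sq_nonneg (H - e)]
  rw [e1]
  have key : K + 4 * D ^ 2 * Real.pi < R * (Wd c - Wd c') := by
    have : (K + 4 * D ^ 2 * Real.pi) / (Wd c - Wd c') < R := by linarith
    rwa [div_lt_iff₀ hw] at this
  have : Real.pi * R ^ 2 + R * Wd c' + K < (∫ θ in (-Real.pi)..Real.pi, (R + Hs c θ - D ^ 2 / R) ^ 2 / 2) := by
    nlinarith
  refine (ENNReal.ofReal_lt_ofReal_iff_of_nonneg ?_).2 this
  rw [← e1]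
  exact intervalIntegral.integral_nonneg (by linarith) fun θ _ => by positivity

end

noncomputable def iL (z : ℤ × ℤ) : Pl := !₂[2 * (z.1 : ℝ) + z.2, Real.sqrt 3 * z.2]

theorem isom_mp (φ : Pl ≃ᵢ Pl) : MeasurePreserving φ volume volume := by
  have h : (φ : Pl → Pl) = (fun x => x + φ 0) ∘ φ.toRealLinearIsometryEquiv := by
    ext1 x; simp
  rw [h]
  exact (measurePreserving_add_right volume (φ 0)).comp
    φ.toRealLinearIsometryEquiv.measurePreserving

theorem vol_isom {ι : Type} [Finite ι] (φ : Pl ≃ᵢ Pl) (c : ι → Pl) (R : ℝ) :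
    volume (⋃ i, closedBall (φ (c i)) R) = volume (⋃ i, closedBall (c i) R) := by
  have := (isom_mp φ).measure_preimage (s := ⋃ i, closedBall (φ (c i)) R)
    (MeasurableSet.iUnion fun _ => isClosed_closedBall.measurableSet).nullMeasurableSet
  rw [← this]
  congr 1
  ext x; simp

theorem box_vol (k : Fin 2) (s R : ℝ) (hs : 0 < s) (hR : 0 < R) :
    volume {p : Pl | ∀ j, |p j| ≤ (if j = k then s / 2 else R / 2)} = ENNReal.ofReal (s * R) := by
  have h1 : {p : Pl | ∀ j, |p j| ≤ (if j = k then s / 2 else R / 2)} =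
      (MeasurableEquiv.toLp 2 (Fin 2 → ℝ)).symm ⁻¹'
        (Set.Icc (fun j => -(if j = k then s / 2 else R / 2)) 
          (fun j => (if j = k then s / 2 else R / 2))) := by
    ext p
    simp only [Set.mem_setOf_eq, abs_le, Set.mem_preimage, Set.mem_Icc, Pi.le_def, ← forall_and]
    rfl
  rw [h1, (EuclideanSpace.volume_preserving_symm_measurableEquiv_toLp (Fin 2)).measure_preimage_equiv,
    Real.volume_Icc_pi, Fin.prod_univ_two, ← ENNReal.ofReal_mul]
  · congr 1; fin_cases k <;> simp; ring
  · fin_cases k <;> simp <;> linarith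

theorem wide_vol {ι : Type} [Finite ι] (c : ι → Pl) (i j : ι) (k : Fin 2) (s R : ℝ) (hs : 0 < s)
    (hsR : s ≤ R) (h : 2 * s ≤ c j k - c i k) :
    ENNReal.ofReal (Real.pi * R ^ 2 + s * R) ≤ volume (⋃ i, closedBall (c i) R) := by
  have hR : 0 < R := by linarith
  have hm : Measurable fun p : Pl => p k := by fun_prop
  set A0 : Set Pl := closedBall 0 R ∩ {p | p k < s} with hA0
  set B0 : Set Pl := closedBall 0 R ∩ {p | -s ≤ p k} with hB0
  have mA0 : MeasurableSet A0 :=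
    isClosed_closedBall.measurableSet.inter (measurableSet_lt hm measurable_const)
  have mB0 : MeasurableSet B0 :=
    isClosed_closedBall.measurableSet.inter (measurableSet_le measurable_const hm)
  have eA : volume ((fun p => p + -(c i)) ⁻¹' A0) = volume A0 :=
    (measurePreserving_add_right volume (-(c i))).measure_preimage mA0.nullMeasurableSet
  have eB : volume ((fun p => p + -(c j)) ⁻¹' B0) = volume B0 :=
    (measurePreserving_add_right volume (-(c j))).measure_preimage mB0.nullMeasurableSet
  have hdisj : Disjoint ((fun p => p + -(c i)) ⁻¹' A0) ((fun p => p + -(c j)) ⁻¹' B0) := by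
    rw [Set.disjoint_left]
    rintro p ⟨-, hp1⟩ ⟨-, hp2⟩
    simp at hp1 hp2
    linarith
  have hsub : ((fun p => p + -(c i)) ⁻¹' A0) ∪ ((fun p => p + -(c j)) ⁻¹' B0) ⊆
      ⋃ i, closedBall (c i) R := by
    rintro p (⟨hp, -⟩ | ⟨hp, -⟩)
    · refine Set.mem_iUnion.2 ⟨i, ?_⟩
      simpa [dist_eq_norm, sub_eq_add_neg] using hp
    · refine Set.mem_iUnion.2 ⟨j, ?_⟩
      simpa [dist_eq_norm, sub_eq_add_neg] using hp
  refine le_trans ?_ (measure_mono hsub)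
  rw [measure_union hdisj (mB0.preimage (by fun_prop)), eA, eB, ← measure_union_add_inter A0 mB0]
  have hU : closedBall (0:Pl) R ⊆ A0 ∪ B0 := by
    intro p hp
    by_cases hk : p k < s
    · exact Or.inl ⟨hp, hk⟩
    · exact Or.inr ⟨hp, by simp at hk ⊢; linarith⟩
  have hI : {p : Pl | ∀ j, |p j| ≤ (if j = k then s / 2 else R / 2)} ⊆ A0 ∩ B0 := by
    intro p hp
    have hpk := hp k
    simp only [if_true] at hpk
    rw [abs_le] at hpk
    have hb : p ∈ closedBall (0:Pl) R := by
      rw [mem_closedBall, dist_zero_right]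
      refine (abs_le_of_sq_le_sq' ?_ hR.le).2
      rw [nsq]
      have hj : ∀ j, p j ^ 2 ≤ (R / 2) ^ 2 := by
        intro j
        rw [sq_le_sq, abs_of_pos (by linarith : 0 < R / 2)]
        refine (hp j).trans ?_
        split_ifs <;> linarith
      nlinarith [hj 0, hj 1]
    exact ⟨⟨hb, by simp; linarith⟩, ⟨hb, by simp; linarith⟩⟩
  calc ENNReal.ofReal (Real.pi * R ^ 2 + s * R)
      = volume (closedBall (0:Pl) R) + ENNReal.ofReal (s * R) := by
        rw [EuclideanSpace.volume_closedBall_fin_two, ENNReal.ofReal_add (by positivity) (by positivity),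
          ENNReal.ofReal_mul (by positivity), ENNReal.ofReal_pow hR.le, mul_comm]
    _ ≤ _ := by
        rw [← box_vol k s R hs hR]
        exact add_le_add (measure_mono hU) (measure_mono hI)

theorem hex_iff (v : Pl) : v ∈ hexLattice ↔ ∃ z : ℤ × ℤ, v = iL z := by
  constructor
  · rintro ⟨a, b, h⟩
    refine ⟨(a, b), ?_⟩
    rw [h]; ext j; fin_cases j <;> simp [iL] <;> ring
  · rintro ⟨⟨a, b⟩, h⟩
    refine ⟨a, b, ?_⟩
    rw [h]; ext j; fin_cases j <;> simp [iL] <;> ring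

theorem iL_sub (x y : ℤ × ℤ) : iL (x - y) = iL x - iL y := by
  ext j; fin_cases j <;> simp [iL] <;> ring

theorem iL_nsq (z : ℤ × ℤ) : ‖iL z‖ ^ 2 = 4 * ((z.1 ^ 2 + z.1 * z.2 + z.2 ^ 2 : ℤ) : ℝ) := by
  rw [nsq]; simp [iL]
  have : Real.sqrt 3 ^ 2 = 3 := Real.sq_sqrt (by norm_num)
  rw [mul_pow, this]; ring

def Packing {ι : Type} (c : ι → Pl) : Prop := ∀ j k, j ≠ k → 2 ≤ ‖c j - c k‖

theorem iL_packing {ι : Type} (z : ι → ℤ × ℤ) (hz : Function.Injective z) :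
    Packing fun i => iL (z i) := by
  intro j k hjk
  rw [← iL_sub]
  refine (abs_le_of_sq_le_sq' ?_ (norm_nonneg _)).2
  rw [iL_nsq]
  have h : z j - z k ≠ 0 := sub_ne_zero.2 fun h => hjk (hz h)
  generalize z j - z k = d at h ⊢
  obtain ⟨a, b⟩ := d
  have : 1 ≤ a ^ 2 + a * b + b ^ 2 := by
    by_contra hc
    have h0 : a ^ 2 + a * b + b ^ 2 = 0 := by nlinarith [sq_nonneg (2 * a + b)]
    have hb : b = 0 := by nlinarith [sq_nonneg (2 * a + b), sq_nonneg b]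
    subst hb
    have ha : a = 0 := by nlinarith
    subst ha; exact h rfl
  have : (1:ℝ) ≤ ((a ^ 2 + a * b + b ^ 2 : ℤ) : ℝ) := by exact_mod_cast this
  simp only; linarith

theorem reduction (n : ℕ) (hn : 0 < n)
    (M : ∀ z : Fin n → ℤ × ℤ, Function.Injective z →
      ∃ c' : Fin n → Pl, Packing c' ∧ Wd c' < Wd fun i => iL (z i)) :
    ∃ lam0 : ℝ, 0 < lam0 ∧ ∀ lam : ℝ, lam0 < lam →
      ∀ c : Fin n → EuclideanSpace ℝ (Fin 2),
        (∀ j k : Fin n, j ≠ k → 2 ≤ ‖c j - c k‖) →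
        (∀ c' : Fin n → EuclideanSpace ℝ (Fin 2),
          (∀ j k : Fin n, j ≠ k → 2 ≤ ‖c' j - c' k‖) →
          volume (⋃ i : Fin n, closedBall (c i) (1 + lam)) ≤
            volume (⋃ i : Fin n, closedBall (c' i) (1 + lam))) →
        ¬ ∃ φ : EuclideanSpace ℝ (Fin 2) ≃ᵢ EuclideanSpace ℝ (Fin 2),
            ∀ i : Fin n, φ (c i) ∈ hexLattice := by
  have : Nonempty (Fin n) := ⟨⟨0, hn⟩⟩
  have M2 : ∀ z : Fin n → ℤ × ℤ, ∃ R0 : ℝ, Function.Injective z →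
      ∃ c' : Fin n → Pl, Packing c' ∧ ∀ R, R0 < R →
        volume (⋃ i, closedBall (c' i) R) < volume (⋃ i, closedBall (iL (z i)) R) := by
    intro z
    by_cases hz : Function.Injective z
    · obtain ⟨c', hc', hW⟩ := M z hz
      obtain ⟨R0, hR0⟩ := vol_compare _ _ hW
      exact ⟨R0, fun _ => ⟨c', hc', hR0⟩⟩
    · exact ⟨0, fun h => absurd h hz⟩
  choose R0 hR0 using M2
  set D : ℝ := 2 * n with hD
  have hDpos : 0 ≤ D := by positivity
  have hpi := Real.pi_pos
  set s : ℝ := 2 * Real.pi * D + 1 with hs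
  have hspos : 0 < s := by positivity
  obtain ⟨K, hK⟩ := exists_nat_gt (4 * s)
  set Z : Finset (Fin n → ℤ × ℤ) :=
    Fintype.piFinset fun _ => (Finset.Icc (-(K:ℤ)) K) ×ˢ (Finset.Icc (-(K:ℤ)) K) with hZ
  set B : ℝ := ∑ z ∈ Z, |R0 z| with hB
  have hBz : ∀ z ∈ Z, R0 z ≤ B := fun z hz =>
    (le_abs_self _).trans (Finset.single_le_sum (f := fun z => |R0 z|) (fun _ _ => abs_nonneg _) hz)
  have hB0 : 0 ≤ B := Finset.sum_nonneg fun _ _ => abs_nonneg _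
  refine ⟨B + s + Real.pi * D ^ 2, by positivity, ?_⟩
  intro lam hlam c hc hmin
  rintro ⟨φ, hφ⟩
  set R := 1 + lam with hRdef
  have hpD : 0 ≤ Real.pi * D ^ 2 := by positivity
  simp_rw [hex_iff] at hφ
  choose z hz using hφ
  set i0 : Fin n := ⟨0, hn⟩
  set w : Fin n → ℤ × ℤ := fun i => z i - z i0 with hw
  set ψ : Pl ≃ᵢ Pl := φ.trans (IsometryEquiv.addRight (-(iL (z i0)))) with hψ
  have hψc : ∀ i, ψ (c i) = iL (w i) := by
    intro i
    show φ (c i) + -(iL (z i0)) = iL (z i - z i0)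
    rw [hz, iL_sub, sub_eq_add_neg]
  have hvol : volume (⋃ i, closedBall (c i) R) = volume (⋃ i, closedBall (iL (w i)) R) := by
    rw [← vol_isom ψ c R]; simp_rw [hψc]
  have hinj : Function.Injective w := by
    intro i j hij
    by_contra hne
    have h2 := hc i j hne
    have : c i = c j := ψ.injective (by rw [hψc, hψc, hij])
    rw [this] at h2; simp at h2; linarith
  by_cases hwide : ∃ i k, 2 * s ≤ |iL (w i) k|
  · obtain ⟨i, k, hik⟩ := hwide
    have h0 : iL (w i0) = 0 := by
      show iL (z i0 - z i0) = 0
      rw [iL_sub, sub_self]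
    have hlow : ENNReal.ofReal (Real.pi * R ^ 2 + s * R) ≤ volume (⋃ i, closedBall (iL (w i)) R) := by
      rcases le_abs.1 hik with h | h
      · refine wide_vol (fun i => iL (w i)) i0 i k s R hspos (by linarith) ?_
        simp only [h0]; simpa using h
      · refine wide_vol (fun i => iL (w i)) i i0 k s R hspos (by linarith) ?_
        simp only [h0]; simpa using h
    have href := hmin (fun i => iL ((i : ℤ), 0))
      (iL_packing _ (fun i j h => by simpa [Fin.ext_iff] using h))
    have hup : volume (⋃ i : Fin n, closedBall (iL ((i : ℤ), 0)) R) ≤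
        ENNReal.ofReal (Real.pi * (R + D) ^ 2) := by
      have : ENNReal.ofReal (Real.pi * (R + D) ^ 2) = volume (closedBall (0:Pl) (R + D)) := by
        rw [EuclideanSpace.volume_closedBall_fin_two, 
          ENNReal.ofReal_mul (by positivity), ENNReal.ofReal_pow (by linarith), mul_comm]
      rw [this]
      refine measure_mono (Set.iUnion_subset fun i => closedBall_subset_closedBall' ?_)
      rw [dist_zero_right]
      have : ‖iL ((i : ℤ), 0)‖ ≤ D := by
        refine (abs_le_of_sq_le_sq' ?_ hDpos).2
        rw [iL_nsq]
        have : (i : ℝ) ≤ n := by exact_mod_cast i.2.le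
        have h0 : (0:ℝ) ≤ i := by positivity
        push_cast; rw [hD]; nlinarith
      linarith
    rw [hvol] at href
    have := hlow.trans (href.trans hup)
    rw [ENNReal.ofReal_le_ofReal_iff (by positivity)] at this
    nlinarith
  · push Not at hwide
    have hwZ : w ∈ Z := by
      rw [hZ, Fintype.mem_piFinset]
      intro i
      have h1 := hwide i 1
      have h0 := hwide i 0
      rw [abs_lt] at h0 h1
      simp [iL] at h0 h1
      have h3 : (1:ℝ) < Real.sqrt 3 := by
        rw [Real.lt_sqrt] <;> norm_num
      rw [Finset.mem_product, Finset.mem_Icc, Finset.mem_Icc]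
      have hb : -(2 * s) < ((w i).2 : ℝ) ∧ ((w i).2 : ℝ) < 2 * s := by
        constructor
        · by_contra hcon; push Not at hcon
          nlinarith
        · by_contra hcon; push Not at hcon
          nlinarith
      refine ⟨⟨?_, ?_⟩, ?_, ?_⟩
      · have : (-(K:ℝ)) ≤ (w i).1 := by linarith
        exact_mod_cast this
      · have : ((w i).1 : ℝ) ≤ K := by linarith
        exact_mod_cast this
      · have : (-(K:ℝ)) ≤ (w i).2 := by linarith
        exact_mod_cast this
      · have : ((w i).2 : ℝ) ≤ K := by linarith
        exact_mod_cast this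
    obtain ⟨c', hc', hlt⟩ := hR0 w hinj
    have := hmin c' hc'
    rw [hvol] at this
    exact absurd (hlt R (by have := hBz w hwZ; linarith)) (not_lt.2 this)

def GoodBasis (e1 e2 : Pl) : Prop :=
  ∀ X Y : ℝ, ‖X • e1 + Y • e2‖ ^ 2 = 4 * (X ^ 2 + X * Y + Y ^ 2)

theorem exists_angle (u : Pl) (hu : u ≠ 0) :
    ∃ θ ∈ Set.Icc (-Real.pi) Real.pi, ∃ t : ℝ, 0 < t ∧ ∀ x : Pl,
      pr x θ = t * (x 0 * u 0 + x 1 * u 1) := by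
  set w : ℂ := ⟨u 0, u 1⟩ with hw
  have hw0 : w ≠ 0 := by
    intro h
    apply hu
    have h0 := congrArg Complex.re h
    have h1 := congrArg Complex.im h
    simp [hw] at h0 h1
    ext j; fin_cases j <;> simp [h0, h1]
  refine ⟨w.arg, ⟨(Complex.neg_pi_lt_arg w).le, Complex.arg_le_pi w⟩, ‖w‖⁻¹,
    by positivity, fun x => ?_⟩
  rw [pr, Complex.cos_arg hw0, Complex.sin_arg]
  simp only [hw]; field_simp

theorem good_dir (e1 e2 : Pl) (h : GoodBasis e1 e2) (δ : ℝ) :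
    ∃ θ ∈ Set.Icc (-Real.pi) Real.pi, ∃ t : ℝ, 0 < t ∧ pr e1 θ = t * δ ∧ pr e2 θ = -t := by
  have h1 := h 1 0
  have h2 := h 0 1
  have h3 := h 1 1
  rw [nsq] at h1 h2 h3
  simp at h1 h2 h3
  have h4 : e1 0 * e2 0 + e1 1 * e2 1 = 2 := by nlinarith
  set u : Pl := ((2 * δ + 1) / 6) • e1 + (-(δ + 2) / 6) • e2 with hu
  have i1 : e1 0 * u 0 + e1 1 * u 1 = δ := by
    simp [hu]; linear_combination (2 * δ + 1) / 6 * h1 - (δ + 2) / 6 * h4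
  have i2 : e2 0 * u 0 + e2 1 * u 1 = -1 := by
    simp [hu]; linear_combination (2 * δ + 1) / 6 * h4 - (δ + 2) / 6 * h2
  have hu0 : u ≠ 0 := by intro h0; rw [h0] at i2; simp at i2
  obtain ⟨θ, hθ, t, ht, hx⟩ := exists_angle u hu0
  exact ⟨θ, hθ, t, ht, by rw [hx, i1], by rw [hx, i2]; ring⟩

theorem W_lt {ι : Type} [Fintype ι] [Nonempty ι] (c c' : ι → Pl) (hle : ∀ θ, Hs c' θ ≤ Hs c θ)
    (hlt : ∃ θ ∈ Set.Icc (-Real.pi) Real.pi, Hs c' θ < Hs c θ) : Wd c' < Wd c := by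
  refine intervalIntegral.integral_lt_integral_of_continuousOn_of_le_of_exists_lt
    (by linarith [Real.pi_pos]) (Hs_cont c').continuousOn (Hs_cont c).continuousOn
    (fun θ _ => hle θ) hlt

theorem pr_conv_le {ι : Type} [Fintype ι] [Nonempty ι] (c : ι → Pl) (i j k : ι) (s t : ℝ) (hs : 0 ≤ s) (ht : 0 ≤ t)
    (hst : s + t ≤ 1) (θ : ℝ) :
    pr (c i) θ + s * (pr (c j) θ - pr (c i) θ) + t * (pr (c k) θ - pr (c i) θ) ≤ Hs c θ := by
  have h1 := le_Hs c θ i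
  have h2 := le_Hs c θ j
  have h3 := le_Hs c θ k
  nlinarith [mul_nonneg hs (sub_nonneg.2 h2), mul_nonneg ht (sub_nonneg.2 h3),
    mul_nonneg (sub_nonneg.2 hst) (sub_nonneg.2 h1)]

theorem Q_fix_q (a b : ℤ) (α : ℝ) (h0 : 0 < α) (h1 : α ≤ 1 / 10) (hb : 0 ≤ b) (hb0 : b = 0 → a ≤ 0)
    (hne : ¬ (a = 1 ∧ b = 1)) : 
    1 ≤ ((a:ℝ) - (1 + α)) ^ 2 + (a - (1 + α)) * (b - (1 - 2 * α)) + (b - (1 - 2 * α)) ^ 2 := by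
  have key : ((a:ℝ) - (1 + α)) ^ 2 + (a - (1 + α)) * (b - (1 - 2 * α)) + (b - (1 - 2 * α)) ^ 2
     = (((a - 1) ^ 2 + (a - 1) * (b - 1) + (b - 1) ^ 2 : ℤ) : ℝ) + 3 * α * ((b - 1 : ℤ):ℝ) + 3 * α ^ 2 := by
    push_cast; ring
  rw [key]
  rcases eq_or_lt_of_le hb with h | h
  · have ha := hb0 h.symm
    have : 3 ≤ (a - 1) ^ 2 + (a - 1) * (b - 1) + (b - 1) ^ 2 := by subst h; nlinarith
    have : (3:ℝ) ≤ (((a - 1) ^ 2 + (a - 1) * (b - 1) + (b - 1) ^ 2 : ℤ) : ℝ) := by exact_mod_cast this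
    have hb' : ((b - 1 : ℤ) : ℝ) = -1 := by rw [← h]; norm_num
    rw [hb']; nlinarith
  · have : 1 ≤ (a - 1) ^ 2 + (a - 1) * (b - 1) + (b - 1) ^ 2 := by
      by_contra hc
      have h0 : (a - 1) ^ 2 + (a - 1) * (b - 1) + (b - 1) ^ 2 = 0 := by nlinarith [sq_nonneg (2 * (a - 1) + (b - 1))]
      have hb : b - 1 = 0 := by nlinarith [sq_nonneg (2 * (a - 1) + (b - 1)), sq_nonneg (b - 1)]
      rw [hb] at h0
      have ha : a - 1 = 0 := by nlinarith
      exact hne ⟨by omega, by omega⟩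
    have : (1:ℝ) ≤ (((a - 1) ^ 2 + (a - 1) * (b - 1) + (b - 1) ^ 2 : ℤ) : ℝ) := by exact_mod_cast this
    have hb' : (0:ℝ) ≤ ((b - 1 : ℤ) : ℝ) := by exact_mod_cast (by omega : 0 ≤ b - 1)
    nlinarith [mul_nonneg h0.le hb', sq_nonneg α]

theorem Q_pos (k l : ℤ) (h : ¬ (k = 0 ∧ l = 0)) : 1 ≤ k ^ 2 + k * l + l ^ 2 := by
  by_contra hc
  have h0 : k ^ 2 + k * l + l ^ 2 = 0 := by nlinarith [sq_nonneg (2 * k + l)]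
  have hb : l = 0 := by nlinarith [sq_nonneg (2 * k + l), sq_nonneg l]
  subst hb
  have ha : k = 0 := by nlinarith
  exact h ⟨ha, rfl⟩

theorem Q_fix_r (a b : ℤ) (β : ℝ) (h0 : 0 < β) (h1 : β ≤ 1 / 10) (hb : 0 ≤ b) (hb0 : b = 0 → a ≤ 0)
    (hne : ¬ (a = 1 ∧ b = 1)) (hne2 : ¬ (a = 0 ∧ b = 1)) : 
    1 ≤ ((a:ℝ) - 2 * β) ^ 2 + (a - 2 * β) * (b - (1 - β)) + (b - (1 - β)) ^ 2 := by
  have key : ((a:ℝ) - 2 * β) ^ 2 + (a - 2 * β) * (b - (1 - β)) + (b - (1 - β)) ^ 2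
     = ((a ^ 2 + a * (b - 1) + (b - 1) ^ 2 : ℤ) : ℝ) - 3 * β * (a:ℝ) + 3 * β ^ 2 := by
    push_cast; ring
  rw [key]
  rcases le_or_gt a 0 with h | h
  · have := Q_pos a (b - 1) (by omega)
    have : (1:ℝ) ≤ ((a ^ 2 + a * (b - 1) + (b - 1) ^ 2 : ℤ) : ℝ) := by exact_mod_cast this
    have ha' : (a : ℝ) ≤ 0 := by exact_mod_cast h
    nlinarith [mul_nonneg h0.le (neg_nonneg.2 ha'), sq_nonneg β]
  · have hb1 : 1 ≤ b := by omega
    have : 1 + a ≤ a ^ 2 + a * (b - 1) + (b - 1) ^ 2 := by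
      rcases le_or_gt 2 a with h2 | h2
      · nlinarith [mul_nonneg h.le (by omega : 0 ≤ b - 1)]
      · have : a = 1 := by omega
        have : 2 ≤ b := by omega
        subst a; nlinarith
    have : (1:ℝ) + a ≤ ((a ^ 2 + a * (b - 1) + (b - 1) ^ 2 : ℤ) : ℝ) := by exact_mod_cast this
    have ha' : (1 : ℝ) ≤ a := by exact_mod_cast h
    nlinarith [sq_nonneg β]

theorem Q_fix_v (a b : ℤ) (γ : ℝ) (h0 : 0 < γ) (h1 : γ ≤ 1 / 10) (hb : 0 ≤ b) (hb0 : b = 0 → a ≤ 0)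
    (hne : ¬ (a = 0 ∧ b = 0)) (hne2 : ¬ (a = 0 ∧ b = 1)) : 
    1 ≤ ((a:ℝ) - γ) ^ 2 + (a - γ) * (b - γ) + (b - γ) ^ 2 := by
  have key : ((a:ℝ) - γ) ^ 2 + (a - γ) * (b - γ) + (b - γ) ^ 2
     = ((a ^ 2 + a * b + b ^ 2 : ℤ) : ℝ) - 3 * γ * ((a + b : ℤ):ℝ) + 3 * γ ^ 2 := by
    push_cast; ring
  rw [key]
  rcases le_or_gt (a + b) 0 with h | h
  · have := Q_pos a b hne
    have : (1:ℝ) ≤ ((a ^ 2 + a * b + b ^ 2 : ℤ) : ℝ) := by exact_mod_cast this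
    have ha' : ((a + b : ℤ) : ℝ) ≤ 0 := by exact_mod_cast h
    nlinarith [mul_nonneg h0.le (neg_nonneg.2 ha'), sq_nonneg γ]
  · have hb1 : 1 ≤ b := by omega
    have : 1 + (a + b) ≤ a ^ 2 + a * b + b ^ 2 := by
      rcases le_or_gt 2 (a + b) with h2 | h2
      · obtain ⟨t, ht⟩ : ∃ t, a = t - b := ⟨a + b, by ring⟩
        subst ht
        have : 2 ≤ t := by linarith
        nlinarith [sq_nonneg (t - 2 * b)]
      · have : a = 1 - b := by omega
        have : 2 ≤ b := by omega
        subst a; nlinarith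
    have : (1:ℝ) + ((a + b : ℤ):ℝ) ≤ ((a ^ 2 + a * b + b ^ 2 : ℤ) : ℝ) := by exact_mod_cast this
    have ha' : (1 : ℝ) ≤ ((a + b : ℤ) : ℝ) := by exact_mod_cast h
    nlinarith [sq_nonneg γ]

theorem Q_rv (β γ : ℝ) (h0 : 0 < γ) (h1 : 0 < β) (hb : β ≤ 1 / 10) (hg : γ ≤ β ^ 2 / 2) :
    1 ≤ (2 * β - γ) ^ 2 + (2 * β - γ) * ((1 - β) - γ) + ((1 - β) - γ) ^ 2 := by
  nlinarith [mul_pos h0 h1, sq_nonneg γ]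

theorem Q_qr (α β : ℝ) (h0 : 0 < β) (h1 : 0 < α) (hb : α ≤ 1 / 10) (hg : β ≤ α ^ 2 / 2) :
    1 ≤ ((1 + α) - 2 * β) ^ 2 + ((1 + α) - 2 * β) * ((1 - 2 * α) - (1 - β)) +
      ((1 - 2 * α) - (1 - β)) ^ 2 := by
  nlinarith [mul_pos h0 h1, sq_nonneg β]

theorem Q_qv (α γ : ℝ) (h0 : 0 < γ) (h1 : 0 < α) (hb : α ≤ 1 / 10) (hg : γ ≤ 1 / 10) :
    1 ≤ ((1 + α) - γ) ^ 2 + ((1 + α) - γ) * ((1 - 2 * α) - γ) + ((1 - 2 * α) - γ) ^ 2 := by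
  nlinarith [mul_pos h0 h1, sq_nonneg γ]

theorem good_dist (e1 e2 : Pl) (h : GoodBasis e1 e2) (T : Pl) (X Y X' Y' : ℝ)
    (hQ : 1 ≤ (X - X') ^ 2 + (X - X') * (Y - Y') + (Y - Y') ^ 2) :
    2 ≤ ‖(T + X • e1 + Y • e2) - (T + X' • e1 + Y' • e2)‖ := by
  have : (T + X • e1 + Y • e2) - (T + X' • e1 + Y' • e2) = (X - X') • e1 + (Y - Y') • e2 := by
    module
  rw [this]
  refine (abs_le_of_sq_le_sq' ?_ (norm_nonneg _)).2
  rw [h]; linarith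

noncomputable def fX (α β γ : ℝ) (z : ℤ × ℤ) : ℝ :=
  if z = (0, 0) then γ else if z = (0, 1) then 2 * β else if z = (1, 1) then 1 + α else z.1

noncomputable def fY (α β γ : ℝ) (z : ℤ × ℤ) : ℝ :=
  if z = (0, 0) then γ else if z = (0, 1) then 1 - β else if z = (1, 1) then 1 - 2 * α else z.2

theorem Q_symm (X Y X' Y' : ℝ) (h : 1 ≤ (X - X') ^ 2 + (X - X') * (Y - Y') + (Y - Y') ^ 2) :
    1 ≤ (X' - X) ^ 2 + (X' - X) * (Y' - Y) + (Y' - Y) ^ 2 := by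
  nlinarith

theorem f_pack (α β γ : ℝ) (hα : 0 < α) (hβ : 0 < β) (hγ : 0 < γ) (h1 : α ≤ 1 / 10)
    (h2 : β ≤ α ^ 2 / 2) (h3 : γ ≤ β ^ 2 / 2) (x y : ℤ × ℤ) (hxy : x ≠ y)
    (hx : 0 ≤ x.2) (hx0 : x.2 = 0 → x.1 ≤ 0) (hy : 0 ≤ y.2) (hy0 : y.2 = 0 → y.1 ≤ 0) :
    1 ≤ (fX α β γ x - fX α β γ y) ^ 2 + (fX α β γ x - fX α β γ y) * (fY α β γ x - fY α β γ y)
      + (fY α β γ x - fY α β γ y) ^ 2 := by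
  have hβ1 : β ≤ 1 / 10 := by nlinarith
  have hγ1 : γ ≤ 1 / 10 := by nlinarith
  obtain ⟨a, b⟩ := x
  obtain ⟨c, d⟩ := y
  simp only [ne_eq, Prod.mk.injEq] at *
  by_cases xv : a = 0 ∧ b = 0
  · obtain ⟨rfl, rfl⟩ := xv
    by_cases yr : c = 0 ∧ d = 1
    · obtain ⟨rfl, rfl⟩ := yr
      simp [fX, fY]
      exact Q_symm _ _ _ _ (Q_rv β γ hγ hβ hβ1 h3)
    by_cases yq : c = 1 ∧ d = 1
    · obtain ⟨rfl, rfl⟩ := yq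
      simp [fX, fY]
      exact Q_symm _ _ _ _ (Q_qv α γ hγ hα h1 hγ1)
    have yv : ¬ (c = 0 ∧ d = 0) := by tauto
    simp [fX, fY, yr, yq, yv]
    exact Q_symm _ _ _ _ (Q_fix_v c d γ hγ hγ1 hy hy0 yv yr)
  by_cases xr : a = 0 ∧ b = 1
  · obtain ⟨rfl, rfl⟩ := xr
    by_cases yv : c = 0 ∧ d = 0
    · obtain ⟨rfl, rfl⟩ := yv
      simp [fX, fY]
      exact (Q_rv β γ hγ hβ hβ1 h3)
    by_cases yq : c = 1 ∧ d = 1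
    · obtain ⟨rfl, rfl⟩ := yq
      simp [fX, fY]
      linarith [Q_qr α β hβ hα h1 h2]
    have yr : ¬ (c = 0 ∧ d = 1) := by tauto
    simp [fX, fY, yr, yq, yv]
    exact Q_symm _ _ _ _ (Q_fix_r c d β hβ hβ1 hy hy0 yq yr)
  by_cases xq : a = 1 ∧ b = 1
  · obtain ⟨rfl, rfl⟩ := xq
    by_cases yv : c = 0 ∧ d = 0
    · obtain ⟨rfl, rfl⟩ := yv
      simp [fX, fY]
      exact (Q_qv α γ hγ hα h1 hγ1)
    by_cases yr : c = 0 ∧ d = 1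
    · obtain ⟨rfl, rfl⟩ := yr
      simp [fX, fY]
      linarith [Q_qr α β hβ hα h1 h2]
    have yq : ¬ (c = 1 ∧ d = 1) := by tauto
    simp [fX, fY, yr, yq, yv]
    exact Q_symm _ _ _ _ (Q_fix_q c d α hα h1 hy hy0 yq)
  by_cases yv : c = 0 ∧ d = 0
  · obtain ⟨rfl, rfl⟩ := yv
    simp [fX, fY, xr, xq, xv]
    exact (Q_fix_v a b γ hγ hγ1 hx hx0 xv xr)
  by_cases yr : c = 0 ∧ d = 1
  · obtain ⟨rfl, rfl⟩ := yr
    simp [fX, fY, xr, xq, xv]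
    exact (Q_fix_r a b β hβ hβ1 hx hx0 xq xr)
  by_cases yq : c = 1 ∧ d = 1
  · obtain ⟨rfl, rfl⟩ := yq
    simp [fX, fY, xr, xq, xv]
    exact (Q_fix_q a b α hα h1 hx hx0 xq)
  simp [fX, fY, xr, xq, xv, yr, yq, yv]
  have := Q_pos (a - c) (b - d) (by omega)
  exact_mod_cast this

set_option maxHeartbeats 1000000 in
theorem local_improve {ι : Type} [Fintype ι] [Nonempty ι] (e1 e2 T : Pl) (hg : GoodBasis e1 e2)
    (z : ι → ℤ × ℤ) (hz : Function.Injective z) (i0 : ι) (hi0 : z i0 = (0, 0))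
    (hb : ∀ i, 0 ≤ (z i).2) (hb0 : ∀ i, (z i).2 = 0 → (z i).1 ≤ 0)
    (iw : ι) (hw : (z iw).2 < (z iw).1) :
    ∃ c' : ι → Pl, Packing c' ∧
      Wd c' < Wd fun i => T + ((z i).1 : ℝ) • e1 + ((z i).2 : ℝ) • e2 := by
  set c : ι → Pl := fun i => T + ((z i).1 : ℝ) • e1 + ((z i).2 : ℝ) • e2 with hc
  have hci0 : c i0 = T := by simp [hc, hi0]
  have hprc : ∀ i θ, pr (c i) θ = pr T θ + (z i).1 * pr e1 θ + (z i).2 * pr e2 θ := by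
    intro i θ; simp [hc, pr_add, pr_smul]
  have hbw : 1 ≤ (z iw).2 := by
    have h1 := hb iw; have h2 := hb0 iw; omega
  set A : ℝ := ((z iw).1 : ℝ) with hA
  set B : ℝ := ((z iw).2 : ℝ) with hB
  have hB1 : 1 ≤ B := by simp only [hB]; exact_mod_cast hbw
  have hAB : B + 1 ≤ A := by simp only [hA, hB]; exact_mod_cast hw

  obtain ⟨δ, hδ0, hδ1, hδ⟩ : ∃ δ : ℝ, 0 < δ ∧ δ ≤ 1 / 4 ∧ ∀ i, ((z i).1 : ℝ) * δ < 1 := by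
    set N : ℝ := ∑ i, |((z i).1 : ℝ)| with hN
    have hN0 : 0 ≤ N := Finset.sum_nonneg fun _ _ => abs_nonneg _
    refine ⟨1 / (4 + N), by positivity, ?_, fun i => ?_⟩
    · exact one_div_le_one_div_of_le (by norm_num) (by linarith)
    · have : ((z i).1 : ℝ) ≤ N := (le_abs_self _).trans
        (Finset.single_le_sum (f := fun i => |((z i).1 : ℝ)|) (fun _ _ => abs_nonneg _) (Finset.mem_univ i))
      rw [mul_one_div, div_lt_one (by positivity)]; linarith
  obtain ⟨θ0, hθ0, t0, ht0, hd1, hd2⟩ := good_dir e1 e2 hg δ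

  have crit : ∀ X Y : ι → ℝ,
      (∀ i j, i ≠ j → 1 ≤ (X i - X j) ^ 2 + (X i - X j) * (Y i - Y j) + (Y i - Y j) ^ 2) →
      (∀ i θ, pr T θ + X i * pr e1 θ + Y i * pr e2 θ ≤ Hs c θ) →
      (∀ i, X i * δ < Y i) →
      ∃ c' : ι → Pl, Packing c' ∧ Wd c' < Wd c := by
    intro X Y hp hH hs
    refine ⟨fun i => T + X i • e1 + Y i • e2, fun i j hij => good_dist e1 e2 hg T _ _ _ _ (hp i j hij), ?_⟩
    refine W_lt _ _ (fun θ => Hs_le _ _ _ fun i => ?_) ⟨θ0, hθ0, ?_⟩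
    · simpa [pr_add, pr_smul] using hH i θ
    · obtain ⟨i, hi⟩ := exists_Hs (fun i => T + X i • e1 + Y i • e2) θ0
      rw [← hi]
      refine lt_of_lt_of_le ?_ (le_Hs c θ0 i0)
      rw [hci0]
      simp only [pr_add, pr_smul, hd1, hd2]
      nlinarith [hs i]
  have hold : ∀ i, z i ≠ (0, 0) → ((z i).1 : ℝ) * δ < (z i).2 := by
    intro i hi
    rcases eq_or_lt_of_le (hb i) with h | h
    · have h1 := hb0 i h.symm
      have h2 : (z i).1 ≤ -1 := by
        by_contra hcon
        apply hi
        ext <;> simp <;> omega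
      have h2' : ((z i).1 : ℝ) ≤ -1 := by exact_mod_cast h2
      rw [← h]; push_cast; nlinarith
    · have : (1:ℝ) ≤ (z i).2 := by exact_mod_cast h
      linarith [hδ i]
  by_cases hx : ∃ ix, ix ≠ i0 ∧ (z ix).1 ≤ (z ix).2
  · obtain ⟨ix, hxne, hxle⟩ := hx
    have hzx : z ix ≠ (0, 0) := fun h => hxne (hz (h.trans hi0.symm))
    set C : ℝ := ((z ix).1 : ℝ) with hC
    set F : ℝ := ((z ix).2 : ℝ) with hF
    have hCF : C ≤ F := by simp only [hC, hF]; exact_mod_cast hxle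
    have hF0 : 0 ≤ F := by simp only [hF]; exact_mod_cast hb ix
    have hN1 : 1 ≤ (F - C) * B + (A - B) * F := by
      rcases eq_or_lt_of_le (hb ix) with h | h
      · have h1 := hb0 ix h.symm
        have h2 : (z ix).1 ≤ -1 := by
          by_contra hcon
          apply hzx
          ext <;> simp <;> omega
        have h2' : C ≤ -1 := by simp only [hC]; exact_mod_cast h2
        have h3 : F = 0 := by simp only [hF]; rw [← h]; simp
        rw [h3]; nlinarith
      · have : 1 ≤ F := by simp only [hF]; exact_mod_cast h
        nlinarith
    set N : ℝ := (F - C) * B + (A - B) * F with hN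
    obtain ⟨α, hα, hα1, hα2⟩ : ∃ α : ℝ, 0 < α ∧ α ≤ 1 / 10 ∧ α * (2 + 3 * B) ≤ 1 := by
      refine ⟨1 / (10 + 3 * B), by positivity, ?_, ?_⟩
      · exact one_div_le_one_div_of_le (by norm_num) (by linarith)
      · rw [div_mul_eq_mul_div, div_le_one (by positivity)]; linarith
    obtain ⟨β, hβ⟩ : ∃ β, β = α ^ 2 / 2 := ⟨_, rfl⟩
    have hβ0 : 0 < β := by rw [hβ]; positivity
    have hβα : β ≤ α / 2 := by nlinarith
    obtain ⟨γ, hγ0, hγ1, hγ2⟩ : ∃ γ : ℝ, 0 < γ ∧ γ ≤ β ^ 2 / 2 ∧ γ * ((F - C) + (A - B)) ≤ 1 := by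
      have hM : 0 < (F - C) + (A - B) := by linarith
      refine ⟨min (β ^ 2 / 2) (1 / ((F - C) + (A - B))), by positivity, min_le_left _ _, ?_⟩
      calc _ ≤ 1 / ((F - C) + (A - B)) * ((F - C) + (A - B)) := by
            gcongr; exact min_le_right _ _
        _ = 1 := by field_simp
    refine crit (fun i => fX α β γ (z i)) (fun i => fY α β γ (z i)) ?_ ?_ ?_
    · intro i j hij
      exact f_pack α β γ hα hβ0 hγ0 hα1 hβ.le hγ1 _ _ (fun h => hij (hz h)) (hb i) (hb0 i) (hb j) (hb0 j)
    · intro i θ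
      by_cases h1 : z i = (0, 0)
      · have := pr_conv_le c i0 iw ix (γ * (F - C) / N) (γ * (A - B) / N)
          (div_nonneg (mul_nonneg hγ0.le (by linarith)) (by linarith))
          (div_nonneg (mul_nonneg hγ0.le (by linarith)) (by linarith))
          (by rw [← add_div, div_le_one (by linarith)]; nlinarith) θ
        refine le_trans (le_of_eq ?_) this
        simp only [fX, fY, h1, if_true, hprc, hi0, ← hA, ← hB, ← hC, ← hF]
        have hNN : N ≠ 0 := by linarith
        push_cast
        field_simp
        rw [hN]; ring
      by_cases h2 : z i = (0, 1)
      · have hA0 : A ≠ 0 := by linarith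
        have := pr_conv_le c i0 iw i (2 * β / A) (1 - β - 2 * β / A * B)
          (div_nonneg (by linarith) (by linarith))
          (by rw [div_mul_eq_mul_div]
              have : 2 * β * B / A ≤ 2 * β := by rw [div_le_iff₀ (by linarith)]; nlinarith
              linarith) 
          (by have : 0 ≤ 2 * β / A := div_nonneg (by linarith) (by linarith)
              linarith [mul_nonneg this (sub_nonneg.2 hB1)]) θ
        refine le_trans (le_of_eq ?_) this
        simp only [fX, fY, h2, hprc, hi0, ← hA, ← hB]
        simp
        field_simp
        ring
      by_cases h3 : z i = (1, 1)
      · have hA0 : A - B ≠ 0 := by linarith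
        have hs : 3 * α / (A - B) ≤ 3 * α := by
          rw [div_le_iff₀ (by linarith)]; nlinarith
        have hs0 : 0 ≤ 3 * α / (A - B) := div_nonneg (by linarith) (by linarith)
        have := pr_conv_le c i0 iw i (3 * α / (A - B)) (1 - 2 * α - 3 * α / (A - B) * B)
          hs0
          (by linarith [mul_nonneg (sub_nonneg.2 hs) (by linarith : 0 ≤ B)]) 
          (by linarith [mul_nonneg hs0 (sub_nonneg.2 hB1)]) θ
        refine le_trans (le_of_eq ?_) this
        simp only [fX, fY, h3, hprc, hi0, ← hA, ← hB]
        simp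
        field_simp
        ring
      · simp only [fX, fY, h1, h2, h3, if_false]
        rw [← hprc]; exact le_Hs c θ i
    · intro i
      by_cases h1 : z i = (0, 0)
      · simp [fX, fY, h1]; nlinarith
      by_cases h2 : z i = (0, 1)
      · simp [fX, fY, h2]; nlinarith
      by_cases h3 : z i = (1, 1)
      · simp [fX, fY, h3]; nlinarith
      · simp only [fX, fY, h1, h2, h3, if_false]
        exact hold i h1
  · push Not at hx
    obtain ⟨γ, hγ0, hγA⟩ : ∃ γ : ℝ, 0 < γ ∧ γ * A ≤ 1 / 10 := by
      have : 0 < A := by linarith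
      exact ⟨1 / (10 * A), by positivity, by field_simp; rfl⟩
    refine crit (fun i => if z i = (0, 0) then γ * A else (z i).1)
      (fun i => if z i = (0, 0) then γ * B else (z i).2) ?_ ?_ ?_
    · have hvx : ∀ i, z i ≠ (0, 0) → 1 ≤ (((z i).1 : ℝ) - γ * A) ^ 2 +
          ((z i).1 - γ * A) * ((z i).2 - γ * B) + ((z i).2 - γ * B) ^ 2 := by
        intro i hi
        have hne : i ≠ i0 := fun h => hi (h ▸ hi0)
        have h1 := hx i hne
        have h2 : 1 ≤ (z i).2 := by have := hb i; have := hb0 i; omega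
        have h3 : 2 ≤ (z i).1 := by omega
        have h2' : (1:ℝ) ≤ (z i).2 := by exact_mod_cast h2
        have h3' : (2:ℝ) ≤ (z i).1 := by exact_mod_cast h3
        have hγB : γ * B ≤ 1 / 10 := by nlinarith
        generalize ((z i).1 : ℝ) = p at *
        generalize ((z i).2 : ℝ) = q at *
        nlinarith [mul_nonneg (by linarith : 0 ≤ p - γ * A) (by linarith : 0 ≤ q - γ * B), sq_nonneg (q - γ * B)]
      intro i j hij
      by_cases h1 : z i = (0, 0)
      · have h2 : z j ≠ (0, 0) := fun h => hij (hz (h1.trans h.symm))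
        simp only [h1, h2, if_true, if_false]
        exact Q_symm _ _ _ _ (hvx j h2)
      by_cases h2 : z j = (0, 0)
      · simp only [h1, h2, if_true, if_false]
        exact hvx i h1
      simp only [h1, h2, if_false]
      have := Q_pos ((z i).1 - (z j).1) ((z i).2 - (z j).2)
        (fun h => hij (hz (Prod.ext (by omega) (by omega))))
      exact_mod_cast this
    · intro i θ
      by_cases h1 : z i = (0, 0)
      · have := pr_conv_le c i0 iw iw γ 0 hγ0.le le_rfl (by nlinarith) θ
        refine le_trans (le_of_eq ?_) this
        simp only [h1, if_true, hprc, hi0, ← hA, ← hB]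
        push_cast; ring
      · simp only [h1, if_false]
        rw [← hprc]; exact le_Hs c θ i
    · intro i
      by_cases h1 : z i = (0, 0)
      · simp only [h1, if_true]
        have := hold iw (by intro h; rw [h] at hbw; simp at hbw)
        rw [← hA, ← hB] at this
        nlinarith
      · simp only [h1, if_false]
        exact hold i h1

/-- The local improvement, in an arbitrary good basis. -/
theorem local_improve' {ι : Type} [Fintype ι] [Nonempty ι] (e1 e2 : Pl) (hg : GoodBasis e1 e2)
    (z : ι → ℤ × ℤ) (hz : Function.Injective z)
    (hno : ¬ ∃ i, ∀ j, (z i).2 ≤ (z j).2 ∧ (z j).1 - (z j).2 ≤ (z i).1 - (z i).2) :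
    ∃ c' : ι → Pl, Packing c' ∧
      Wd c' < Wd fun i => ((z i).1 : ℝ) • e1 + ((z i).2 : ℝ) • e2 := by
  classical
  obtain ⟨m, hm⟩ := Finite.exists_min fun i => (z i).2
  obtain ⟨i0, hi0S, hi0⟩ := Finset.exists_max_image (Finset.univ.filter fun i => (z i).2 = (z m).2)
    (fun i => (z i).1) ⟨m, by simp⟩
  simp at hi0S hi0
  push Not at hno
  obtain ⟨iw, hiw⟩ := hno i0
  have hiw' := hiw (by rw [hi0S]; exact hm iw)
  have := local_improve e1 e2 (((z i0).1 : ℝ) • e1 + ((z i0).2 : ℝ) • e2) hg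
    (fun i => z i - z i0) (fun i j h => hz (by simpa using h)) i0 (by simp [Prod.ext_iff])
    (by intro i; simp; rw [hi0S]; exact hm i)
    (by
      intro i h; simp at h ⊢
      exact hi0 i (by omega)) iw (by simp; omega)
  convert this using 6 with c' i
  simp
  module

def triS (c : ℕ) : Finset (Σ _ : ℕ, ℕ) := (Finset.range c).sigma fun s => Finset.range (s + 1)

theorem triS_card (c : ℕ) : 2 * (triS c).card = c * (c + 1) := by
  rw [triS, Finset.card_sigma]
  simp only [Finset.card_range]
  induction c with
  | zero => simp
  | succ k ih => rw [Finset.sum_range_succ, mul_add, ih]; ring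

def tri (c : ℕ) (f : ℤ → ℤ → ℤ × ℤ) : Finset (ℤ × ℤ) :=
  (triS c).image fun p => f p.2 ((p.1 : ℤ) - p.2)

theorem tri_mem (c : ℕ) (f : ℤ → ℤ → ℤ × ℤ) (p : ℤ × ℤ) :
    p ∈ tri c f ↔ ∃ i j : ℤ, 0 ≤ i ∧ 0 ≤ j ∧ i + j < c ∧ p = f i j := by
  simp only [tri, Finset.mem_image, triS, Finset.mem_sigma, Finset.mem_range]
  constructor
  · rintro ⟨⟨s, t⟩, ⟨h1, h2⟩, rfl⟩
    simp only at h1 h2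
    exact ⟨t, s - t, by omega, by omega, by omega, rfl⟩
  · rintro ⟨i, j, hi, hj, hij, rfl⟩
    refine ⟨⟨(i + j).toNat, i.toNat⟩, ⟨by simp only; omega, by simp only; omega⟩, ?_⟩
    simp only
    congr 1 <;> omega

theorem tri_card (c : ℕ) (f : ℤ → ℤ → ℤ × ℤ)
    (hf : ∀ i j i' j', f i j = f i' j' → i = i' ∧ j = j') : 2 * (tri c f).card = c * (c + 1) := by
  rw [tri, Finset.card_image_of_injOn, triS_card]
  rintro ⟨s, t⟩ h ⟨s', t'⟩ h' heq
  obtain ⟨h1, h2⟩ := hf _ _ _ _ heq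
  simp only at h1 h2
  have e1 : t = t' := by omega
  have e2 : s = s' := by omega
  subst e1 e2; rfl

set_option maxHeartbeats 1000000 in
theorem count_upper (S : Finset (ℤ × ℤ)) (X Y L M c1 c3 c5 c7 c9 c11 : ℕ)
    (hS : ∀ p ∈ S, 0 ≤ p.1 ∧ p.1 ≤ X ∧ 0 ≤ p.2 ∧ p.2 ≤ Y ∧ (L:ℤ) ≤ p.1 + p.2 ∧ p.1 + p.2 ≤ X + Y - M
      ∧ p.1 - p.2 ≤ X - c1 ∧ 2 * p.1 + p.2 ≤ 2 * X + Y - M - c3 ∧ p.1 + 2 * p.2 ≤ X + 2 * Y - M - c5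
      ∧ p.2 - p.1 ≤ Y - c7 ∧ (L:ℤ) + c9 ≤ 2 * p.1 + p.2 ∧ (L:ℤ) + c11 ≤ p.1 + 2 * p.2)
    (hb : L + c11 + c1 ≤ X) (hr : M + c1 + c3 ≤ Y) (hM : c3 + c5 ≤ M) (ht : M + c5 + c7 ≤ X)
    (hl : L + c7 + c9 ≤ Y) (hL : c9 + c11 ≤ L) :
    2 * S.card + L * (L + 1) + M * (M + 1) + c1 * (c1 + 1) + c3 * (c3 + 1) + c5 * (c5 + 1)
      + c7 * (c7 + 1) + c9 * (c9 + 1) + c11 * (c11 + 1) ≤ 2 * ((X + 1) * (Y + 1)) := by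
  classical
  set tL := tri L fun i j => (i, j) with htL
  set tM := tri M fun i j => ((X:ℤ) - i, (Y:ℤ) - j) with htM
  set t1 := tri c1 fun i j => ((X:ℤ) - i, j) with ht1
  set t3 := tri c3 fun i j => ((X:ℤ) - i, (Y:ℤ) - M + i - j) with ht3
  set t5 := tri c5 fun i j => ((X:ℤ) - M + i - j, (Y:ℤ) - i) with ht5
  set t7 := tri c7 fun i j => (i, (Y:ℤ) - j) with ht7
  set t9 := tri c9 fun i j => (i, (L:ℤ) - i + j) with ht9
  set t11 := tri c11 fun i j => ((L:ℤ) - i + j, i) with ht11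
  have kL : 2 * tL.card = L * (L + 1) := tri_card _ _ (by intro i j i1 j1 h; simp only [Prod.mk.injEq] at h; omega)
  have kM : 2 * tM.card = M * (M + 1) := tri_card _ _ (by intro i j i1 j1 h; simp only [Prod.mk.injEq] at h; omega)
  have k1 : 2 * t1.card = c1 * (c1 + 1) := tri_card _ _ (by intro i j i1 j1 h; simp only [Prod.mk.injEq] at h; omega)
  have k3 : 2 * t3.card = c3 * (c3 + 1) := tri_card _ _ (by intro i j i1 j1 h; simp only [Prod.mk.injEq] at h; omega)
  have k5 : 2 * t5.card = c5 * (c5 + 1) := tri_card _ _ (by intro i j i1 j1 h; simp only [Prod.mk.injEq] at h; omega)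
  have k7 : 2 * t7.card = c7 * (c7 + 1) := tri_card _ _ (by intro i j i1 j1 h; simp only [Prod.mk.injEq] at h; omega)
  have k9 : 2 * t9.card = c9 * (c9 + 1) := tri_card _ _ (by intro i j i1 j1 h; simp only [Prod.mk.injEq] at h; omega)
  have k11 : 2 * t11.card = c11 * (c11 + 1) := tri_card _ _ (by intro i j i1 j1 h; simp only [Prod.mk.injEq] at h; omega)
  have mL : ∀ p ∈ tL, 0 ≤ p.1 ∧ 0 ≤ p.2 ∧ p.1 + p.2 < L := by
    intro p hp; obtain ⟨i, j, _, _, _, rfl⟩ := (tri_mem _ _ _).1 hp; simp only; omega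
  have mM : ∀ p ∈ tM, p.1 ≤ X ∧ p.2 ≤ Y ∧ (X:ℤ) + Y - M < p.1 + p.2 := by
    intro p hp; obtain ⟨i, j, _, _, _, rfl⟩ := (tri_mem _ _ _).1 hp; simp only; omega
  have m1 : ∀ p ∈ t1, p.1 ≤ X ∧ 0 ≤ p.2 ∧ (X:ℤ) - c1 < p.1 - p.2 := by
    intro p hp; obtain ⟨i, j, _, _, _, rfl⟩ := (tri_mem _ _ _).1 hp; simp only; omega
  have m3 : ∀ p ∈ t3, p.1 ≤ X ∧ p.1 + p.2 ≤ X + Y - M ∧ 2 * (X:ℤ) + Y - M - c3 < 2 * p.1 + p.2 := by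
    intro p hp; obtain ⟨i, j, _, _, _, rfl⟩ := (tri_mem _ _ _).1 hp; simp only; omega
  have m5 : ∀ p ∈ t5, p.2 ≤ Y ∧ p.1 + p.2 ≤ X + Y - M ∧ (X:ℤ) + 2 * Y - M - c5 < p.1 + 2 * p.2 := by
    intro p hp; obtain ⟨i, j, _, _, _, rfl⟩ := (tri_mem _ _ _).1 hp; simp only; omega
  have m7 : ∀ p ∈ t7, p.2 ≤ Y ∧ 0 ≤ p.1 ∧ (Y:ℤ) - c7 < p.2 - p.1 := by
    intro p hp; obtain ⟨i, j, _, _, _, rfl⟩ := (tri_mem _ _ _).1 hp; simp only; omega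
  have m9 : ∀ p ∈ t9, 0 ≤ p.1 ∧ (L:ℤ) ≤ p.1 + p.2 ∧ 2 * p.1 + p.2 < L + c9 := by
    intro p hp; obtain ⟨i, j, _, _, _, rfl⟩ := (tri_mem _ _ _).1 hp; simp only; omega
  have m11 : ∀ p ∈ t11, 0 ≤ p.2 ∧ (L:ℤ) ≤ p.1 + p.2 ∧ p.1 + 2 * p.2 < L + c11 := by
    intro p hp; obtain ⟨i, j, _, _, _, rfl⟩ := (tri_mem _ _ _).1 hp; simp only; omega
  have dL : Disjoint S tL := by
    rw [Finset.disjoint_left]; intro p hp hq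
    have := hS p hp; have := mL p hq; omega
  have dM : Disjoint (S ∪ tL) tM := by
    rw [Finset.disjoint_left]; intro p hp hq
    simp only [Finset.mem_union] at hp
    have := mM p hq
    rcases hp with hp | hp
    · have := hS p hp; omega
    · have := mL p hp; omega
  have d1 : Disjoint (S ∪ tL ∪ tM) t1 := by
    rw [Finset.disjoint_left]; intro p hp hq
    simp only [Finset.mem_union] at hp
    have := m1 p hq
    rcases hp with (hp | hp) | hp
    · have := hS p hp; omega
    · have := mL p hp; omega
    · have := mM p hp; omega
  have d3 : Disjoint (S ∪ tL ∪ tM ∪ t1) t3 := by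
    rw [Finset.disjoint_left]; intro p hp hq
    simp only [Finset.mem_union] at hp
    have := m3 p hq
    rcases hp with ((hp | hp) | hp) | hp
    · have := hS p hp; omega
    · have := mL p hp; omega
    · have := mM p hp; omega
    · have := m1 p hp; omega
  have d5 : Disjoint (S ∪ tL ∪ tM ∪ t1 ∪ t3) t5 := by
    rw [Finset.disjoint_left]; intro p hp hq
    simp only [Finset.mem_union] at hp
    have := m5 p hq
    rcases hp with (((hp | hp) | hp) | hp) | hp
    · have := hS p hp; omega
    · have := mL p hp; omega
    · have := mM p hp; omega
    · have := m1 p hp; omega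
    · have := m3 p hp; omega
  have d7 : Disjoint (S ∪ tL ∪ tM ∪ t1 ∪ t3 ∪ t5) t7 := by
    rw [Finset.disjoint_left]; intro p hp hq
    simp only [Finset.mem_union] at hp
    have := m7 p hq
    rcases hp with ((((hp | hp) | hp) | hp) | hp) | hp
    · have := hS p hp; omega
    · have := mL p hp; omega
    · have := mM p hp; omega
    · have := m1 p hp; omega
    · have := m3 p hp; omega
    · have := m5 p hp; omega
  have d9 : Disjoint (S ∪ tL ∪ tM ∪ t1 ∪ t3 ∪ t5 ∪ t7) t9 := by
    rw [Finset.disjoint_left]; intro p hp hq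
    simp only [Finset.mem_union] at hp
    have := m9 p hq
    rcases hp with (((((hp | hp) | hp) | hp) | hp) | hp) | hp
    · have := hS p hp; omega
    · have := mL p hp; omega
    · have := mM p hp; omega
    · have := m1 p hp; omega
    · have := m3 p hp; omega
    · have := m5 p hp; omega
    · have := m7 p hp; omega
  have d11 : Disjoint (S ∪ tL ∪ tM ∪ t1 ∪ t3 ∪ t5 ∪ t7 ∪ t9) t11 := by
    rw [Finset.disjoint_left]; intro p hp hq
    simp only [Finset.mem_union] at hp
    have := m11 p hq
    rcases hp with ((((((hp | hp) | hp) | hp) | hp) | hp) | hp) | hp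
    · have := hS p hp; omega
    · have := mL p hp; omega
    · have := mM p hp; omega
    · have := m1 p hp; omega
    · have := m3 p hp; omega
    · have := m5 p hp; omega
    · have := m7 p hp; omega
    · have := m9 p hp; omega
  have hsub : S ∪ tL ∪ tM ∪ t1 ∪ t3 ∪ t5 ∪ t7 ∪ t9 ∪ t11 ⊆
      Finset.Icc (0:ℤ) X ×ˢ Finset.Icc (0:ℤ) Y := by
    intro p hp
    simp only [Finset.mem_union] at hp
    rw [Finset.mem_product, Finset.mem_Icc, Finset.mem_Icc]
    rcases hp with (((((((hp | hp) | hp) | hp) | hp) | hp) | hp) | hp) | hp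
    · have := hS p hp; omega
    · have := mL p hp; omega
    · have := mM p hp; omega
    · have := m1 p hp; omega
    · have := m3 p hp; omega
    · have := m5 p hp; omega
    · have := m7 p hp; omega
    · have := m9 p hp; omega
    · have := m11 p hp; omega
  have hcard := Finset.card_le_card hsub
  rw [Finset.card_union_of_disjoint d11, Finset.card_union_of_disjoint d9,
    Finset.card_union_of_disjoint d7, Finset.card_union_of_disjoint d5,
    Finset.card_union_of_disjoint d3, Finset.card_union_of_disjoint d1,
    Finset.card_union_of_disjoint dM, Finset.card_union_of_disjoint dL,
    Finset.card_product, Int.card_Icc, Int.card_Icc] at hcard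
  have e1 : ((X:ℤ) + 1 - 0).toNat = X + 1 := by omega
  have e2 : ((Y:ℤ) + 1 - 0).toNat = Y + 1 := by omega
  rw [e1, e2] at hcard
  omega

def hh (m : ℕ) : ℕ := (m ^ 2 + 6 * m + 12) / 12

def bal (k : ℕ) : ℕ := 3 * ((k / 6) * (k / 6 + 1)) + (k / 6 + 1) * (k % 6)

theorem bal_le (k c1 c2 c3 c4 c5 c6 : ℕ) (hk : k = c1 + c2 + c3 + c4 + c5 + c6) :
    2 * bal k ≤ c1 * (c1 + 1) + c2 * (c2 + 1) + c3 * (c3 + 1) + c4 * (c4 + 1) + c5 * (c5 + 1)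
      + c6 * (c6 + 1) := by
  have h : ∀ c q : ℕ, (q:ℤ) * (q + 1) + 2 * (q + 1) * (c - q) ≤ c * (c + 1) := by
    intro c q
    have : (0:ℤ) ≤ ((c:ℤ) - q) * (c - q - 1) := by
      rcases le_or_gt ((c:ℤ) - q) 0 with h | h
      · nlinarith
      · exact mul_nonneg h.le (by omega)
    nlinarith
  set q := k / 6 with hq
  set r := k % 6 with hr
  have hkq : k = 6 * q + r := by omega
  have e : bal k = 3 * (q * (q + 1)) + (q + 1) * r := rfl
  rw [e]
  zify
  have hr' : (r:ℤ) = c1 + c2 + c3 + c4 + c5 + c6 - 6 * q := by push_cast [← hk]; omega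
  rw [hr']
  nlinarith [h c1 q, h c2 q, h c3 q, h c4 q, h c5 q, h c6 q]

theorem count_final (n X Y L M c1 c3 c5 c7 c9 c11 : ℕ)
    (h : 2 * n + L * (L + 1) + M * (M + 1) + c1 * (c1 + 1) + c3 * (c3 + 1) + c5 * (c5 + 1)
      + c7 * (c7 + 1) + c9 * (c9 + 1) + c11 * (c11 + 1) ≤ 2 * ((X + 1) * (Y + 1)))
    (m k : ℕ) (hm : m + L + M = 2 * X + 2 * Y) (hk : k = c1 + c3 + c5 + c7 + c9 + c11) :
    n + bal k ≤ hh m := by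
  have h1 := bal_le k c1 c3 c5 c7 c9 c11 hk
  rw [hh, Nat.le_div_iff_mul_le (by norm_num)]
  have h2 : 2 * n + 2 * bal k + L * (L + 1) + M * (M + 1) ≤ 2 * ((X + 1) * (Y + 1)) := by omega
  zify at h2 hm ⊢
  have hm' : (m:ℤ) = 2 * X + 2 * Y - L - M := by linarith
  rw [hm']
  nlinarith [sq_nonneg ((X:ℤ) - Y), sq_nonneg ((L:ℤ) - M), sq_nonneg ((X:ℤ) + Y - 2 * (L + M))]

theorem arc_or {ι : Type} [Fintype ι] [Nonempty ι] (z : ι → ℤ × ℤ) (hz : Function.Injective z)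
    (p1 p2 s1 s2 g11 g12 g21 g22 : ℤ)
    (h1 : g11 * (s1 - p1) - g12 * p1 = 1) (h2 : g11 * (s2 - p2) - g12 * p2 = 0)
    (h3 : g21 * (s1 - p1) - g22 * p1 = 0) (h4 : g21 * (s2 - p2) - g22 * p2 = 1)
    (q1 : g11 ^ 2 + g11 * g21 + g21 ^ 2 = 1) (q2 : g12 ^ 2 + g12 * g22 + g22 ^ 2 = 1)
    (q3 : 2 * g11 * g12 + g11 * g22 + g12 * g21 + 2 * g21 * g22 = 1)
    (hno : ¬ ∃ c' : ι → Pl, Packing c' ∧ Wd c' < Wd fun i => iL (z i)) :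
    ∃ i, ∀ k, p1 * (z k).1 + p2 * (z k).2 ≤ p1 * (z i).1 + p2 * (z i).2 ∧
      s1 * (z k).1 + s2 * (z k).2 ≤ s1 * (z i).1 + s2 * (z i).2 := by
  by_contra hcon
  apply hno
  set w : ι → ℤ × ℤ := fun i =>
    ((s1 - p1) * (z i).1 + (s2 - p2) * (z i).2, -p1 * (z i).1 - p2 * (z i).2) with hw
  have hx : ∀ i, (z i).1 = g11 * (w i).1 + g12 * (w i).2 := by
    intro i; simp only [hw]; linear_combination -(z i).1 * h1 - (z i).2 * h2
  have hy : ∀ i, (z i).2 = g21 * (w i).1 + g22 * (w i).2 := by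
    intro i; simp only [hw]; linear_combination -(z i).1 * h3 - (z i).2 * h4
  have hg : GoodBasis (iL (g11, g21)) (iL (g12, g22)) := by
    intro X Y
    have q1' : (g11:ℝ) ^ 2 + g11 * g21 + g21 ^ 2 = 1 := by exact_mod_cast q1
    have q2' : (g12:ℝ) ^ 2 + g12 * g22 + g22 ^ 2 = 1 := by exact_mod_cast q2
    have q3' : 2 * (g11:ℝ) * g12 + g11 * g22 + g12 * g21 + 2 * g21 * g22 = 1 := by exact_mod_cast q3
    have hs : Real.sqrt 3 ^ 2 = 3 := Real.sq_sqrt (by norm_num)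
    rw [nsq]; simp [iL]
    linear_combination (X * g21 + Y * g22) ^ 2 * hs + 4 * X ^ 2 * q1' + 4 * Y ^ 2 * q2' + 4 * X * Y * q3'
  have := local_improve' _ _ hg w (fun i j h => hz (Prod.ext (by rw [hx, hx, h]) (by rw [hy, hy, h])))
    (by
      rintro ⟨i, hi⟩
      apply hcon
      refine ⟨i, fun k => ?_⟩
      have := hi k
      simp only [hw] at this
      constructor
      · linarith
      · linarith)
  convert this using 6 with c' i
  ext j; fin_cases j
  · simp [iL, hx, hy]; ring
  · simp [iL, hx, hy]; ring

noncomputable def ang (j : ℕ) : ℝ := -(Real.pi / 2) + j * (Real.pi / 6)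

theorem pr_periodic (x : Pl) (θ : ℝ) : pr x (θ + 2 * Real.pi) = pr x θ := by simp [pr]

theorem Hs_periodic {ι : Type} (c : ι → Pl) : Function.Periodic (Hs c) (2 * Real.pi) := by
  intro θ; simp only [Hs, pr_periodic]

theorem integral_pr (x : Pl) (a b : ℝ) : ∫ θ in a..b, pr x θ =
    x 0 * (Real.sin b - Real.sin a) + x 1 * (Real.cos a - Real.cos b) := by
  unfold pr
  rw [intervalIntegral.integral_add, intervalIntegral.integral_const_mul,
    intervalIntegral.integral_const_mul, integral_cos, integral_sin]
  all_goals exact (by fun_prop : Continuous _).intervalIntegrable _ _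

theorem integral_arc (x : Pl) (a : ℝ) : ∫ θ in a..(a + Real.pi / 6), pr x θ =
    (2 - Real.sqrt 3) * (pr x a + pr x (a + Real.pi / 6)) := by
  rw [integral_pr]
  have hs : Real.sqrt 3 ^ 2 = 3 := Real.sq_sqrt (by norm_num)
  simp only [pr, Real.sin_add, Real.cos_add, Real.cos_pi_div_six, Real.sin_pi_div_six]
  linear_combination (1 / 2 * (x 0 * Real.cos a + x 1 * Real.sin a)) * hs

theorem W_ge_arcs {ι : Type} [Fintype ι] [Nonempty ι] (c : ι → Pl) (i : ℕ → ι) :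
    ∑ j ∈ Finset.range 12, (2 - Real.sqrt 3) * (pr (c (i j)) (ang j) + pr (c (i j)) (ang (j + 1)))
      ≤ Wd c := by
  have e1 : Wd c = ∫ θ in (ang 0)..(ang 12), Hs c θ := by
    have := (Hs_periodic c).intervalIntegral_add_eq (-Real.pi) (ang 0)
    rw [Wd]
    convert this using 2
    · ring
    · simp [ang]; ring
  have hi : ∀ a b, IntervalIntegrable (Hs c) volume a b := fun a b =>
    (Hs_cont c).intervalIntegrable _ _
  rw [e1, ← intervalIntegral.sum_integral_adjacent_intervals (fun k _ => hi _ _)]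
  refine Finset.sum_le_sum fun j _ => ?_
  have e2 : ang (j + 1) = ang j + Real.pi / 6 := by simp [ang]; ring
  rw [e2, ← integral_arc]
  refine intervalIntegral.integral_mono_on (by linarith [Real.pi_pos])
    ((pr_cont _).intervalIntegrable _ _) (hi _ _) fun θ _ => le_Hs c θ _

theorem ang_add_six (x : Pl) (j : ℕ) : pr x (ang (j + 6)) = -pr x (ang j) := by
  have : ang (j + 6) = ang j + Real.pi := by simp [ang]; ring
  rw [this]; simp [pr]; ring

theorem pr_ang0 (z : ℤ × ℤ) : pr (iL z) (ang 0) = Real.sqrt 3 * (-z.2 : ℤ) := by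
  simp [pr, iL, ang]
theorem pr_ang1 (z : ℤ × ℤ) : pr (iL z) (ang 1) = (z.1 - z.2 : ℤ) := by
  have hs : Real.sqrt 3 ^ 2 = 3 := Real.sq_sqrt (by norm_num)
  have : ang 1 = -(Real.pi / 3) := by simp [ang]; ring
  rw [this]; simp [pr, iL]; linear_combination -(z.2:ℝ) / 2 * hs
theorem pr_ang2 (z : ℤ × ℤ) : pr (iL z) (ang 2) = Real.sqrt 3 * (z.1 : ℤ) := by
  have : ang 2 = -(Real.pi / 6) := by simp [ang]; ring
  rw [this]; simp [pr, iL]; ring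
theorem pr_ang3 (z : ℤ × ℤ) : pr (iL z) (ang 3) = (2 * z.1 + z.2 : ℤ) := by
  have : ang 3 = 0 := by simp [ang]; ring
  rw [this]; simp [pr, iL]
theorem pr_ang4 (z : ℤ × ℤ) : pr (iL z) (ang 4) = Real.sqrt 3 * (z.1 + z.2 : ℤ) := by
  have : ang 4 = (Real.pi / 6) := by simp [ang]; ring
  rw [this]; simp [pr, iL]; ring
theorem pr_ang5 (z : ℤ × ℤ) : pr (iL z) (ang 5) = (z.1 + 2 * z.2 : ℤ) := by
  have hs : Real.sqrt 3 ^ 2 = 3 := Real.sq_sqrt (by norm_num)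
  have : ang 5 = (Real.pi / 3) := by simp [ang]; ring
  rw [this]; simp [pr, iL]; linear_combination (z.2:ℝ) / 2 * hs
theorem pr_ang6 (z : ℤ × ℤ) : pr (iL z) (ang 6) = Real.sqrt 3 * (z.2 : ℤ) := by
  rw [ang_add_six _ 0, pr_ang0]; push_cast; ring
theorem pr_ang7 (z : ℤ × ℤ) : pr (iL z) (ang 7) = (z.2 - z.1 : ℤ) := by
  rw [ang_add_six _ 1, pr_ang1]; push_cast; ring
theorem pr_ang8 (z : ℤ × ℤ) : pr (iL z) (ang 8) = Real.sqrt 3 * (-z.1 : ℤ) := by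
  rw [ang_add_six _ 2, pr_ang2]; push_cast; ring
theorem pr_ang9 (z : ℤ × ℤ) : pr (iL z) (ang 9) = (-2 * z.1 - z.2 : ℤ) := by
  rw [ang_add_six _ 3, pr_ang3]; push_cast; ring
theorem pr_ang10 (z : ℤ × ℤ) : pr (iL z) (ang 10) = Real.sqrt 3 * (-z.1 - z.2 : ℤ) := by
  rw [ang_add_six _ 4, pr_ang4]; push_cast; ring
theorem pr_ang11 (z : ℤ × ℤ) : pr (iL z) (ang 11) = (-z.1 - 2 * z.2 : ℤ) := by
  rw [ang_add_six _ 5, pr_ang5]; push_cast; ring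
theorem pr_ang12 (z : ℤ × ℤ) : pr (iL z) (ang 12) = Real.sqrt 3 * (-z.2 : ℤ) := by
  rw [ang_add_six _ 6, pr_ang6]; push_cast; ring

theorem case_core (n : ℕ) (z : Fin n → ℤ × ℤ) (hz : Function.Injective z) (i : ℕ → Fin n)
    (h0 : ∀ k, 0 * (z k).1 + (-1) * (z k).2 ≤ 0 * (z (i 0)).1 + (-1) * (z (i 0)).2 ∧
      1 * (z k).1 + (-1) * (z k).2 ≤ 1 * (z (i 0)).1 + (-1) * (z (i 0)).2)
    (h1 : ∀ k, 1 * (z k).1 + 0 * (z k).2 ≤ 1 * (z (i 1)).1 + 0 * (z (i 1)).2 ∧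
      1 * (z k).1 + (-1) * (z k).2 ≤ 1 * (z (i 1)).1 + (-1) * (z (i 1)).2)
    (h2 : ∀ k, 1 * (z k).1 + 0 * (z k).2 ≤ 1 * (z (i 2)).1 + 0 * (z (i 2)).2 ∧
      2 * (z k).1 + 1 * (z k).2 ≤ 2 * (z (i 2)).1 + 1 * (z (i 2)).2)
    (h3 : ∀ k, 1 * (z k).1 + 1 * (z k).2 ≤ 1 * (z (i 3)).1 + 1 * (z (i 3)).2 ∧
      2 * (z k).1 + 1 * (z k).2 ≤ 2 * (z (i 3)).1 + 1 * (z (i 3)).2)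
    (h4 : ∀ k, 1 * (z k).1 + 1 * (z k).2 ≤ 1 * (z (i 4)).1 + 1 * (z (i 4)).2 ∧
      1 * (z k).1 + 2 * (z k).2 ≤ 1 * (z (i 4)).1 + 2 * (z (i 4)).2)
    (h5 : ∀ k, 0 * (z k).1 + 1 * (z k).2 ≤ 0 * (z (i 5)).1 + 1 * (z (i 5)).2 ∧
      1 * (z k).1 + 2 * (z k).2 ≤ 1 * (z (i 5)).1 + 2 * (z (i 5)).2)
    (h6 : ∀ k, 0 * (z k).1 + 1 * (z k).2 ≤ 0 * (z (i 6)).1 + 1 * (z (i 6)).2 ∧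
      (-1) * (z k).1 + 1 * (z k).2 ≤ (-1) * (z (i 6)).1 + 1 * (z (i 6)).2)
    (h7 : ∀ k, (-1) * (z k).1 + 0 * (z k).2 ≤ (-1) * (z (i 7)).1 + 0 * (z (i 7)).2 ∧
      (-1) * (z k).1 + 1 * (z k).2 ≤ (-1) * (z (i 7)).1 + 1 * (z (i 7)).2)
    (h8 : ∀ k, (-1) * (z k).1 + 0 * (z k).2 ≤ (-1) * (z (i 8)).1 + 0 * (z (i 8)).2 ∧
      (-2) * (z k).1 + (-1) * (z k).2 ≤ (-2) * (z (i 8)).1 + (-1) * (z (i 8)).2)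
    (h9 : ∀ k, (-1) * (z k).1 + (-1) * (z k).2 ≤ (-1) * (z (i 9)).1 + (-1) * (z (i 9)).2 ∧
      (-2) * (z k).1 + (-1) * (z k).2 ≤ (-2) * (z (i 9)).1 + (-1) * (z (i 9)).2)
    (h10 : ∀ k, (-1) * (z k).1 + (-1) * (z k).2 ≤ (-1) * (z (i 10)).1 + (-1) * (z (i 10)).2 ∧
      (-1) * (z k).1 + (-2) * (z k).2 ≤ (-1) * (z (i 10)).1 + (-2) * (z (i 10)).2)
    (h11 : ∀ k, 0 * (z k).1 + (-1) * (z k).2 ≤ 0 * (z (i 11)).1 + (-1) * (z (i 11)).2 ∧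
      (-1) * (z k).1 + (-2) * (z k).2 ≤ (-1) * (z (i 11)).1 + (-2) * (z (i 11)).2)
    : ∃ M0 M1 M2 M3 M4 M5 M6 M7 M8 M9 M10 M11 : ℤ, ∃ m k : ℕ, n + bal k ≤ hh m ∧
      (m : ℤ) = M0 + M2 + M4 + M6 + M8 + M10 ∧ (k : ℤ) = 2 * m - (M1 + M3 + M5 + M7 + M9 + M11) ∧
      0 * (z (i 0)).1 + (-1) * (z (i 0)).2 = M0 ∧ 1 * (z (i 0)).1 + (-1) * (z (i 0)).2 = M1 ∧
      1 * (z (i 1)).1 + 0 * (z (i 1)).2 = M2 ∧ 1 * (z (i 1)).1 + (-1) * (z (i 1)).2 = M1 ∧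
      1 * (z (i 2)).1 + 0 * (z (i 2)).2 = M2 ∧ 2 * (z (i 2)).1 + 1 * (z (i 2)).2 = M3 ∧
      1 * (z (i 3)).1 + 1 * (z (i 3)).2 = M4 ∧ 2 * (z (i 3)).1 + 1 * (z (i 3)).2 = M3 ∧
      1 * (z (i 4)).1 + 1 * (z (i 4)).2 = M4 ∧ 1 * (z (i 4)).1 + 2 * (z (i 4)).2 = M5 ∧
      0 * (z (i 5)).1 + 1 * (z (i 5)).2 = M6 ∧ 1 * (z (i 5)).1 + 2 * (z (i 5)).2 = M5 ∧
      0 * (z (i 6)).1 + 1 * (z (i 6)).2 = M6 ∧ (-1) * (z (i 6)).1 + 1 * (z (i 6)).2 = M7 ∧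
      (-1) * (z (i 7)).1 + 0 * (z (i 7)).2 = M8 ∧ (-1) * (z (i 7)).1 + 1 * (z (i 7)).2 = M7 ∧
      (-1) * (z (i 8)).1 + 0 * (z (i 8)).2 = M8 ∧ (-2) * (z (i 8)).1 + (-1) * (z (i 8)).2 = M9 ∧
      (-1) * (z (i 9)).1 + (-1) * (z (i 9)).2 = M10 ∧ (-2) * (z (i 9)).1 + (-1) * (z (i 9)).2 = M9 ∧
      (-1) * (z (i 10)).1 + (-1) * (z (i 10)).2 = M10 ∧ (-1) * (z (i 10)).1 + (-2) * (z (i 10)).2 = M11 ∧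
      0 * (z (i 11)).1 + (-1) * (z (i 11)).2 = M0 ∧ (-1) * (z (i 11)).1 + (-2) * (z (i 11)).2 = M11 := by
  obtain ⟨M0, hM0⟩ : ∃ t : ℤ, t = 0 * (z (i 0)).1 + (-1) * (z (i 0)).2 := ⟨_, rfl⟩
  obtain ⟨M1, hM1⟩ : ∃ t : ℤ, t = 1 * (z (i 0)).1 + (-1) * (z (i 0)).2 := ⟨_, rfl⟩
  obtain ⟨M2, hM2⟩ : ∃ t : ℤ, t = 1 * (z (i 1)).1 + 0 * (z (i 1)).2 := ⟨_, rfl⟩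
  obtain ⟨M3, hM3⟩ : ∃ t : ℤ, t = 2 * (z (i 2)).1 + 1 * (z (i 2)).2 := ⟨_, rfl⟩
  obtain ⟨M4, hM4⟩ : ∃ t : ℤ, t = 1 * (z (i 3)).1 + 1 * (z (i 3)).2 := ⟨_, rfl⟩
  obtain ⟨M5, hM5⟩ : ∃ t : ℤ, t = 1 * (z (i 4)).1 + 2 * (z (i 4)).2 := ⟨_, rfl⟩
  obtain ⟨M6, hM6⟩ : ∃ t : ℤ, t = 0 * (z (i 5)).1 + 1 * (z (i 5)).2 := ⟨_, rfl⟩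
  obtain ⟨M7, hM7⟩ : ∃ t : ℤ, t = (-1) * (z (i 6)).1 + 1 * (z (i 6)).2 := ⟨_, rfl⟩
  obtain ⟨M8, hM8⟩ : ∃ t : ℤ, t = (-1) * (z (i 7)).1 + 0 * (z (i 7)).2 := ⟨_, rfl⟩
  obtain ⟨M9, hM9⟩ : ∃ t : ℤ, t = (-2) * (z (i 8)).1 + (-1) * (z (i 8)).2 := ⟨_, rfl⟩
  obtain ⟨M10, hM10⟩ : ∃ t : ℤ, t = (-1) * (z (i 9)).1 + (-1) * (z (i 9)).2 := ⟨_, rfl⟩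
  obtain ⟨M11, hM11⟩ : ∃ t : ℤ, t = (-1) * (z (i 10)).1 + (-2) * (z (i 10)).2 := ⟨_, rfl⟩
  have e0_0 : 0 * (z (i 0)).1 + (-1) * (z (i 0)).2 = M0 := hM0.symm
  have e0_1 : 1 * (z (i 0)).1 + (-1) * (z (i 0)).2 = M1 := hM1.symm
  have e1_2 : 1 * (z (i 1)).1 + 0 * (z (i 1)).2 = M2 := hM2.symm
  have e1_1 : 1 * (z (i 1)).1 + (-1) * (z (i 1)).2 = M1 := by
    rw [hM1]; exact le_antisymm (h0 _).2 (h1 _).2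
  have e2_2 : 1 * (z (i 2)).1 + 0 * (z (i 2)).2 = M2 := by
    rw [hM2]; exact le_antisymm (h1 _).1 (h2 _).1
  have e2_3 : 2 * (z (i 2)).1 + 1 * (z (i 2)).2 = M3 := hM3.symm
  have e3_4 : 1 * (z (i 3)).1 + 1 * (z (i 3)).2 = M4 := hM4.symm
  have e3_3 : 2 * (z (i 3)).1 + 1 * (z (i 3)).2 = M3 := by
    rw [hM3]; exact le_antisymm (h2 _).2 (h3 _).2
  have e4_4 : 1 * (z (i 4)).1 + 1 * (z (i 4)).2 = M4 := by
    rw [hM4]; exact le_antisymm (h3 _).1 (h4 _).1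
  have e4_5 : 1 * (z (i 4)).1 + 2 * (z (i 4)).2 = M5 := hM5.symm
  have e5_6 : 0 * (z (i 5)).1 + 1 * (z (i 5)).2 = M6 := hM6.symm
  have e5_5 : 1 * (z (i 5)).1 + 2 * (z (i 5)).2 = M5 := by
    rw [hM5]; exact le_antisymm (h4 _).2 (h5 _).2
  have e6_6 : 0 * (z (i 6)).1 + 1 * (z (i 6)).2 = M6 := by
    rw [hM6]; exact le_antisymm (h5 _).1 (h6 _).1
  have e6_7 : (-1) * (z (i 6)).1 + 1 * (z (i 6)).2 = M7 := hM7.symm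
  have e7_8 : (-1) * (z (i 7)).1 + 0 * (z (i 7)).2 = M8 := hM8.symm
  have e7_7 : (-1) * (z (i 7)).1 + 1 * (z (i 7)).2 = M7 := by
    rw [hM7]; exact le_antisymm (h6 _).2 (h7 _).2
  have e8_8 : (-1) * (z (i 8)).1 + 0 * (z (i 8)).2 = M8 := by
    rw [hM8]; exact le_antisymm (h7 _).1 (h8 _).1
  have e8_9 : (-2) * (z (i 8)).1 + (-1) * (z (i 8)).2 = M9 := hM9.symm
  have e9_10 : (-1) * (z (i 9)).1 + (-1) * (z (i 9)).2 = M10 := hM10.symm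
  have e9_9 : (-2) * (z (i 9)).1 + (-1) * (z (i 9)).2 = M9 := by
    rw [hM9]; exact le_antisymm (h8 _).2 (h9 _).2
  have e10_10 : (-1) * (z (i 10)).1 + (-1) * (z (i 10)).2 = M10 := by
    rw [hM10]; exact le_antisymm (h9 _).1 (h10 _).1
  have e10_11 : (-1) * (z (i 10)).1 + (-2) * (z (i 10)).2 = M11 := hM11.symm
  have e11_0 : 0 * (z (i 11)).1 + (-1) * (z (i 11)).2 = M0 := by
    rw [hM0]; exact le_antisymm (h0 _).1 (h11 _).1
  have e11_11 : (-1) * (z (i 11)).1 + (-2) * (z (i 11)).2 = M11 := by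
    rw [hM11]; exact le_antisymm (h10 _).2 (h11 _).2
  have b0 : ∀ k, 0 * (z k).1 + (-1) * (z k).2 ≤ M0 := fun k => by rw [hM0]; exact (h0 k).1
  have b1 : ∀ k, 1 * (z k).1 + (-1) * (z k).2 ≤ M1 := fun k => by rw [hM1]; exact (h0 k).2
  have b2 : ∀ k, 1 * (z k).1 + 0 * (z k).2 ≤ M2 := fun k => by rw [hM2]; exact (h1 k).1
  have b3 : ∀ k, 2 * (z k).1 + 1 * (z k).2 ≤ M3 := fun k => by rw [hM3]; exact (h2 k).2
  have b4 : ∀ k, 1 * (z k).1 + 1 * (z k).2 ≤ M4 := fun k => by rw [hM4]; exact (h3 k).1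
  have b5 : ∀ k, 1 * (z k).1 + 2 * (z k).2 ≤ M5 := fun k => by rw [hM5]; exact (h4 k).2
  have b6 : ∀ k, 0 * (z k).1 + 1 * (z k).2 ≤ M6 := fun k => by rw [hM6]; exact (h5 k).1
  have b7 : ∀ k, (-1) * (z k).1 + 1 * (z k).2 ≤ M7 := fun k => by rw [hM7]; exact (h6 k).2
  have b8 : ∀ k, (-1) * (z k).1 + 0 * (z k).2 ≤ M8 := fun k => by rw [hM8]; exact (h7 k).1
  have b9 : ∀ k, (-2) * (z k).1 + (-1) * (z k).2 ≤ M9 := fun k => by rw [hM9]; exact (h8 k).2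
  have b10 : ∀ k, (-1) * (z k).1 + (-1) * (z k).2 ≤ M10 := fun k => by rw [hM10]; exact (h9 k).1
  have b11 : ∀ k, (-1) * (z k).1 + (-2) * (z k).2 ≤ M11 := fun k => by rw [hM11]; exact (h10 k).2
  clear hM0 hM1 hM2 hM3 hM4 hM5 hM6 hM7 hM8 hM9 hM10 hM11 h0 h1 h2 h3 h4 h5 h6 h7 h8 h9 h10 h11
  obtain ⟨X, hX⟩ := Int.eq_ofNat_of_zero_le (show (0:ℤ) ≤ M2-(-M8) by linarith [b0 (i 2), b2 (i 2), b4 (i 2), b6 (i 2), b8 (i 2), b10 (i 2), e2_2, e2_3])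
  obtain ⟨Y, hY⟩ := Int.eq_ofNat_of_zero_le (show (0:ℤ) ≤ M6-(-M0) by linarith [b0 (i 5), b2 (i 5), b4 (i 5), b6 (i 5), b8 (i 5), b10 (i 5), e5_6, e5_5])
  obtain ⟨L, hL⟩ := Int.eq_ofNat_of_zero_le (show (0:ℤ) ≤ (-M10)-(-M8)-(-M0) by linarith [b0 (i 9), b2 (i 9), b4 (i 9), b6 (i 9), b8 (i 9), b10 (i 9), e9_10, e9_9])
  obtain ⟨M, hM⟩ := Int.eq_ofNat_of_zero_le (show (0:ℤ) ≤ M2+M6-M4 by linarith [b0 (i 3), b2 (i 3), b4 (i 3), b6 (i 3), b8 (i 3), b10 (i 3), e3_4, e3_3])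
  obtain ⟨c1, hc1⟩ := Int.eq_ofNat_of_zero_le (show (0:ℤ) ≤ M2-(-M0)-M1 by linarith [b0 (i 0), b2 (i 0), b4 (i 0), b6 (i 0), b8 (i 0), b10 (i 0), e0_0, e0_1])
  obtain ⟨c3, hc3⟩ := Int.eq_ofNat_of_zero_le (show (0:ℤ) ≤ M2+M4-M3 by linarith [b0 (i 2), b2 (i 2), b4 (i 2), b6 (i 2), b8 (i 2), b10 (i 2), e2_2, e2_3])
  obtain ⟨c5, hc5⟩ := Int.eq_ofNat_of_zero_le (show (0:ℤ) ≤ M4+M6-M5 by linarith [b0 (i 4), b2 (i 4), b4 (i 4), b6 (i 4), b8 (i 4), b10 (i 4), e4_4, e4_5])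
  obtain ⟨c7, hc7⟩ := Int.eq_ofNat_of_zero_le (show (0:ℤ) ≤ M6-(-M8)-M7 by linarith [b0 (i 6), b2 (i 6), b4 (i 6), b6 (i 6), b8 (i 6), b10 (i 6), e6_6, e6_7])
  obtain ⟨c9, hc9⟩ := Int.eq_ofNat_of_zero_le (show (0:ℤ) ≤ -(-M8)-(-M10)-M9 by linarith [b0 (i 8), b2 (i 8), b4 (i 8), b6 (i 8), b8 (i 8), b10 (i 8), e8_8, e8_9])
  obtain ⟨c11, hc11⟩ := Int.eq_ofNat_of_zero_le (show (0:ℤ) ≤ -(-M10)-(-M0)-M11 by linarith [b0 (i 10), b2 (i 10), b4 (i 10), b6 (i 10), b8 (i 10), b10 (i 10), e10_10, e10_11])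
  have hb : L+c11+c1≤X := by zify; linarith [b0 (i 0), b1 (i 0), b2 (i 0), b3 (i 0), b4 (i 0), b5 (i 0), b6 (i 0), b7 (i 0), b8 (i 0), b9 (i 0), b10 (i 0), b11 (i 0), b0 (i 11), b1 (i 11), b2 (i 11), b3 (i 11), b4 (i 11), b5 (i 11), b6 (i 11), b7 (i 11), b8 (i 11), b9 (i 11), b10 (i 11), b11 (i 11), e0_0, e0_1, e11_0, e11_11]
  have hr : M+c1+c3≤Y := by zify; linarith [b0 (i 1), b1 (i 1), b2 (i 1), b3 (i 1), b4 (i 1), b5 (i 1), b6 (i 1), b7 (i 1), b8 (i 1), b9 (i 1), b10 (i 1), b11 (i 1), b0 (i 2), b1 (i 2), b2 (i 2), b3 (i 2), b4 (i 2), b5 (i 2), b6 (i 2), b7 (i 2), b8 (i 2), b9 (i 2), b10 (i 2), b11 (i 2), e1_2, e1_1, e2_2, e2_3]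
  have hMM : c3+c5≤M := by zify; linarith [b0 (i 3), b1 (i 3), b2 (i 3), b3 (i 3), b4 (i 3), b5 (i 3), b6 (i 3), b7 (i 3), b8 (i 3), b9 (i 3), b10 (i 3), b11 (i 3), b0 (i 4), b1 (i 4), b2 (i 4), b3 (i 4), b4 (i 4), b5 (i 4), b6 (i 4), b7 (i 4), b8 (i 4), b9 (i 4), b10 (i 4), b11 (i 4), e3_4, e3_3, e4_4, e4_5]
  have ht : M+c5+c7≤X := by zify; linarith [b0 (i 5), b1 (i 5), b2 (i 5), b3 (i 5), b4 (i 5), b5 (i 5), b6 (i 5), b7 (i 5), b8 (i 5), b9 (i 5), b10 (i 5), b11 (i 5), b0 (i 6), b1 (i 6), b2 (i 6), b3 (i 6), b4 (i 6), b5 (i 6), b6 (i 6), b7 (i 6), b8 (i 6), b9 (i 6), b10 (i 6), b11 (i 6), e5_6, e5_5, e6_6, e6_7]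
  have hl : L+c7+c9≤Y := by zify; linarith [b0 (i 7), b1 (i 7), b2 (i 7), b3 (i 7), b4 (i 7), b5 (i 7), b6 (i 7), b7 (i 7), b8 (i 7), b9 (i 7), b10 (i 7), b11 (i 7), b0 (i 8), b1 (i 8), b2 (i 8), b3 (i 8), b4 (i 8), b5 (i 8), b6 (i 8), b7 (i 8), b8 (i 8), b9 (i 8), b10 (i 8), b11 (i 8), e7_8, e7_7, e8_8, e8_9]
  have hLL : c9+c11≤L := by zify; linarith [b0 (i 9), b1 (i 9), b2 (i 9), b3 (i 9), b4 (i 9), b5 (i 9), b6 (i 9), b7 (i 9), b8 (i 9), b9 (i 9), b10 (i 9), b11 (i 9), b0 (i 10), b1 (i 10), b2 (i 10), b3 (i 10), b4 (i 10), b5 (i 10), b6 (i 10), b7 (i 10), b8 (i 10), b9 (i 10), b10 (i 10), b11 (i 10), e9_10, e9_9, e10_10, e10_11]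
  have hcard : (Finset.univ.image fun k => ((z k).1 + M8, (z k).2 + M0)).card = n := by
    rw [Finset.card_image_of_injective, Finset.card_univ, Fintype.card_fin]
    intro a b hab
    simp only [Prod.mk.injEq, add_left_inj] at hab
    exact hz (Prod.ext hab.1 hab.2)
  have hcu := count_upper (Finset.univ.image fun k => ((z k).1 + M8, (z k).2 + M0)) X Y L M c1 c3 c5 c7 c9 c11 (by
    intro p hp
    simp only [Finset.mem_image, Finset.mem_univ, true_and] at hp
    obtain ⟨k, rfl⟩ := hp
    have := b0 k; have := b1 k; have := b2 k; have := b3 k; have := b4 k; have := b5 k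
    have := b6 k; have := b7 k; have := b8 k; have := b9 k; have := b10 k; have := b11 k
    refine ⟨?_, ?_, ?_, ?_, ?_, ?_, ?_, ?_, ?_, ?_, ?_, ?_⟩ <;> dsimp only <;> linarith) hb hr hMM ht hl hLL
  rw [hcard] at hcu
  obtain ⟨m, hm⟩ := Int.eq_ofNat_of_zero_le (show (0:ℤ) ≤ M0 + M2 + M4 + M6 + M8 + M10 by
    linarith [b0 (i 0), b2 (i 0), b4 (i 0), b6 (i 0), b8 (i 0), b10 (i 0)])
  refine ⟨M0, M1, M2, M3, M4, M5, M6, M7, M8, M9, M10, M11, m, c1+c3+c5+c7+c9+c11, ?_, hm.symm, ?_, e0_0, e0_1, e1_2, e1_1, e2_2, e2_3, e3_4, e3_3, e4_4, e4_5, e5_6, e5_5, e6_6, e6_7, e7_8, e7_7, e8_8, e8_9, e9_10, e9_9, e10_10, e10_11, e11_0, e11_11⟩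
  · exact count_final n X Y L M c1 c3 c5 c7 c9 c11 hcu m _ (by zify; linarith) rfl
  · push_cast; linarith

set_option maxHeartbeats 1000000 in
theorem case_split (n : ℕ) [Nonempty (Fin n)] (z : Fin n → ℤ × ℤ) (hz : Function.Injective z)
    (hno : ¬ ∃ c' : Fin n → Pl, Packing c' ∧ Wd c' < Wd fun i => iL (z i)) :
    ∃ m k : ℕ, n + bal k ≤ hh m ∧ 2 * (m - (2 - Real.sqrt 3) * k) ≤ Wd fun i => iL (z i) := by
  obtain ⟨i0, h0⟩ := arc_or z hz 0 (-1) 1 (-1) 1 0 0 1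
    (by norm_num) (by norm_num) (by norm_num) (by norm_num) (by norm_num) (by norm_num) (by norm_num) hno
  obtain ⟨i1, h1⟩ := arc_or z hz 1 0 1 (-1) 0 (-1) (-1) 0
    (by norm_num) (by norm_num) (by norm_num) (by norm_num) (by norm_num) (by norm_num) (by norm_num) hno
  obtain ⟨i2, h2⟩ := arc_or z hz 1 0 2 1 0 (-1) 1 1
    (by norm_num) (by norm_num) (by norm_num) (by norm_num) (by norm_num) (by norm_num) (by norm_num) hno
  obtain ⟨i3, h3⟩ := arc_or z hz 1 1 2 1 1 0 (-1) (-1)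
    (by norm_num) (by norm_num) (by norm_num) (by norm_num) (by norm_num) (by norm_num) (by norm_num) hno
  obtain ⟨i4, h4⟩ := arc_or z hz 1 1 1 2 (-1) (-1) 1 0
    (by norm_num) (by norm_num) (by norm_num) (by norm_num) (by norm_num) (by norm_num) (by norm_num) hno
  obtain ⟨i5, h5⟩ := arc_or z hz 0 1 1 2 1 1 0 (-1)
    (by norm_num) (by norm_num) (by norm_num) (by norm_num) (by norm_num) (by norm_num) (by norm_num) hno
  obtain ⟨i6, h6⟩ := arc_or z hz 0 1 (-1) 1 (-1) 0 0 (-1)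
    (by norm_num) (by norm_num) (by norm_num) (by norm_num) (by norm_num) (by norm_num) (by norm_num) hno
  obtain ⟨i7, h7⟩ := arc_or z hz (-1) 0 (-1) 1 0 1 1 0
    (by norm_num) (by norm_num) (by norm_num) (by norm_num) (by norm_num) (by norm_num) (by norm_num) hno
  obtain ⟨i8, h8⟩ := arc_or z hz (-1) 0 (-2) (-1) 0 1 (-1) (-1)
    (by norm_num) (by norm_num) (by norm_num) (by norm_num) (by norm_num) (by norm_num) (by norm_num) hno
  obtain ⟨i9, h9⟩ := arc_or z hz (-1) (-1) (-2) (-1) (-1) 0 1 1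
    (by norm_num) (by norm_num) (by norm_num) (by norm_num) (by norm_num) (by norm_num) (by norm_num) hno
  obtain ⟨i10, h10⟩ := arc_or z hz (-1) (-1) (-1) (-2) 1 1 (-1) 0
    (by norm_num) (by norm_num) (by norm_num) (by norm_num) (by norm_num) (by norm_num) (by norm_num) hno
  obtain ⟨i11, h11⟩ := arc_or z hz 0 (-1) (-1) (-2) (-1) (-1) 0 1
    (by norm_num) (by norm_num) (by norm_num) (by norm_num) (by norm_num) (by norm_num) (by norm_num) hno
  let i : ℕ → Fin n := fun j => match j with
    | 0 => i0
    | 1 => i1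
    | 2 => i2
    | 3 => i3
    | 4 => i4
    | 5 => i5
    | 6 => i6
    | 7 => i7
    | 8 => i8
    | 9 => i9
    | 10 => i10
    | 11 => i11
    | _ => i0
  obtain ⟨M0, M1, M2, M3, M4, M5, M6, M7, M8, M9, M10, M11, m, k, hmk, hm, hk, e0, f0, e1, f1, e2, f2, e3, f3, e4, f4, e5, f5, e6, f6, e7, f7, e8, f8, e9, f9, e10, f10, e11, f11⟩ :=
    case_core n z hz i h0 h1 h2 h3 h4 h5 h6 h7 h8 h9 h10 h11
  refine ⟨m, k, hmk, ?_⟩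
  have hW := W_ge_arcs (fun k => iL (z k)) i
  simp only [Finset.sum_range_succ, Finset.sum_range_zero, zero_add] at hW
  have q0 : pr (iL (z (i 0))) (ang 0) + pr (iL (z (i 0))) (ang 1) = √3 * M0 + M1 := by
    rw [pr_ang0, pr_ang1, ← e0, ← f0]; push_cast; ring
  have q1 : pr (iL (z (i 1))) (ang 1) + pr (iL (z (i 1))) (ang 2) = √3 * M2 + M1 := by
    rw [pr_ang1, pr_ang2, ← e1, ← f1]; push_cast; ring
  have q2 : pr (iL (z (i 2))) (ang 2) + pr (iL (z (i 2))) (ang 3) = √3 * M2 + M3 := by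
    rw [pr_ang2, pr_ang3, ← e2, ← f2]; push_cast; ring
  have q3 : pr (iL (z (i 3))) (ang 3) + pr (iL (z (i 3))) (ang 4) = √3 * M4 + M3 := by
    rw [pr_ang3, pr_ang4, ← e3, ← f3]; push_cast; ring
  have q4 : pr (iL (z (i 4))) (ang 4) + pr (iL (z (i 4))) (ang 5) = √3 * M4 + M5 := by
    rw [pr_ang4, pr_ang5, ← e4, ← f4]; push_cast; ring
  have q5 : pr (iL (z (i 5))) (ang 5) + pr (iL (z (i 5))) (ang 6) = √3 * M6 + M5 := by
    rw [pr_ang5, pr_ang6, ← e5, ← f5]; push_cast; ring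
  have q6 : pr (iL (z (i 6))) (ang 6) + pr (iL (z (i 6))) (ang 7) = √3 * M6 + M7 := by
    rw [pr_ang6, pr_ang7, ← e6, ← f6]; push_cast; ring
  have q7 : pr (iL (z (i 7))) (ang 7) + pr (iL (z (i 7))) (ang 8) = √3 * M8 + M7 := by
    rw [pr_ang7, pr_ang8, ← e7, ← f7]; push_cast; ring
  have q8 : pr (iL (z (i 8))) (ang 8) + pr (iL (z (i 8))) (ang 9) = √3 * M8 + M9 := by
    rw [pr_ang8, pr_ang9, ← e8, ← f8]; push_cast; ring
  have q9 : pr (iL (z (i 9))) (ang 9) + pr (iL (z (i 9))) (ang 10) = √3 * M10 + M9 := by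
    rw [pr_ang9, pr_ang10, ← e9, ← f9]; push_cast; ring
  have q10 : pr (iL (z (i 10))) (ang 10) + pr (iL (z (i 10))) (ang 11) = √3 * M10 + M11 := by
    rw [pr_ang10, pr_ang11, ← e10, ← f10]; push_cast; ring
  have q11 : pr (iL (z (i 11))) (ang 11) + pr (iL (z (i 11))) (ang 12) = √3 * M0 + M11 := by
    rw [pr_ang11, pr_ang12, ← e11, ← f11]; push_cast; ring
  have hs : Real.sqrt 3 ^ 2 = 3 := Real.sq_sqrt (by norm_num)
  have hm' : (m : ℝ) = M0 + M2 + M4 + M6 + M8 + M10 := by exact_mod_cast hm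
  have hk' : (k : ℝ) = 2 * m - (M1 + M3 + M5 + M7 + M9 + M11) := by exact_mod_cast hk
  refine le_trans (le_of_eq ?_) hW
  push_cast at q0 q1 q2 q3 q4 q5 q6 q7 q8 q9 q10 q11 ⊢
  norm_num at q0 q1 q2 q3 q4 q5 q6 q7 q8 q9 q10 q11 ⊢
  rw [q0, q1, q2, q3, q4, q5, q6, q7, q8, q9, q10, q11, hk', hm']
  linear_combination (2 * (M0 + M2 + M4 + M6 + M8 + M10 : ℝ)) * hs

theorem int_abs_cos : ∫ θ in (-Real.pi)..Real.pi, |Real.cos θ| = 4 := by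
  have hi : ∀ a b, IntervalIntegrable (fun θ => |Real.cos θ|) volume a b := fun a b =>
    (by fun_prop : Continuous fun θ => |Real.cos θ|).intervalIntegrable _ _
  have hp := Real.pi_pos
  rw [← intervalIntegral.integral_add_adjacent_intervals (hi _ (-(Real.pi / 2))) (hi _ _),
    ← intervalIntegral.integral_add_adjacent_intervals (hi (-(Real.pi / 2)) (Real.pi / 2)) (hi _ _)]
  have e1 : ∫ θ in (-Real.pi)..(-(Real.pi / 2)), |Real.cos θ| = ∫ θ in (-Real.pi)..(-(Real.pi / 2)), - Real.cos θ := by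
    apply intervalIntegral.integral_congr
    intro x hx
    rw [Set.uIcc_of_le (by linarith)] at hx
    apply abs_of_nonpos
    rw [← Real.cos_neg]
    exact Real.cos_nonpos_of_pi_div_two_le_of_le (by linarith [hx.2]) (by linarith [hx.1])
  have e2 : ∫ θ in (-(Real.pi / 2))..(Real.pi / 2), |Real.cos θ| = ∫ θ in (-(Real.pi / 2))..(Real.pi / 2), Real.cos θ := by
    apply intervalIntegral.integral_congr
    intro x hx
    rw [Set.uIcc_of_le (by linarith)] at hx
    apply abs_of_nonneg
    exact Real.cos_nonneg_of_neg_pi_div_two_le_of_le (by linarith [hx.1]) (by linarith [hx.2])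
  have e3 : ∫ θ in (Real.pi / 2)..Real.pi, |Real.cos θ| = ∫ θ in (Real.pi / 2)..Real.pi, - Real.cos θ := by
    apply intervalIntegral.integral_congr
    intro x hx
    rw [Set.uIcc_of_le (by linarith)] at hx
    apply abs_of_nonpos
    exact Real.cos_nonpos_of_pi_div_two_le_of_le (by linarith [hx.1]) (by linarith [hx.2])
  rw [e1, e2, e3]
  simp only [intervalIntegral.integral_neg, integral_cos]
  simp [Real.sin_neg]
  norm_num

theorem int_abs_pr (x : Pl) : ∫ θ in (-Real.pi)..Real.pi, |pr x θ| = 4 * ‖x‖ := by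
  set w : ℂ := ⟨x 0, x 1⟩ with hw
  have hn : ‖w‖ = ‖x‖ := by
    rw [← sq_eq_sq₀ (norm_nonneg _) (norm_nonneg _), nsq, ← Complex.normSq_eq_norm_sq, Complex.normSq_apply]
    simp only [hw]; ring
  have h0 : x 0 = ‖x‖ * Real.cos w.arg := by rw [← hn, Complex.norm_mul_cos_arg]
  have h1 : x 1 = ‖x‖ * Real.sin w.arg := by rw [← hn, Complex.norm_mul_sin_arg]
  have e : ∀ θ, |pr x θ| = ‖x‖ * |Real.cos (θ - w.arg)| := by
    intro θ
    have e' : pr x θ = ‖x‖ * Real.cos (θ - w.arg) := by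
      rw [pr, Real.cos_sub]; linear_combination Real.cos θ * h0 + Real.sin θ * h1
    rw [e', abs_mul, abs_of_nonneg (norm_nonneg x)]
  simp_rw [e]
  rw [intervalIntegral.integral_const_mul, intervalIntegral.integral_comp_sub_right (fun θ => |Real.cos θ|)]
  have hper : Function.Periodic (fun θ => |Real.cos θ|) (2 * Real.pi) := fun θ => by simp
  have := hper.intervalIntegral_add_eq (-Real.pi - w.arg) (-Real.pi)
  have e1 : -Real.pi - w.arg + 2 * Real.pi = Real.pi - w.arg := by ring
  have e2 : -Real.pi + 2 * Real.pi = Real.pi := by ring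
  rw [e1, e2] at this
  rw [this, int_abs_cos]; ring

theorem closed_var (f : ℕ → ℝ) (N a b : ℕ) (ha : a ≤ N) (hb : b ≤ N) (h : f N = f 0) :
    2 * (f a - f b) ≤ ∑ j ∈ Finset.range N, |f (j + 1) - f j| := by
  have key : ∀ p q : ℕ, p ≤ q → q ≤ N → 2 * |f p - f q| ≤ ∑ j ∈ Finset.range N, |f (j + 1) - f j| := by
    intro p q hpq hq
    have e : ∀ i, |f (i + 1) - f i| = dist (f i) (f (i + 1)) := fun i => by
      rw [Real.dist_eq, abs_sub_comm]
    simp_rw [e]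
    have h1 := dist_le_Ico_sum_dist f hpq
    have h2 := dist_le_Ico_sum_dist f (Nat.zero_le p)
    have h3 := dist_le_Ico_sum_dist f hq
    have h4 := Finset.sum_Ico_consecutive (fun i => dist (f i) (f (i + 1))) (Nat.zero_le p) hpq
    have h5 := Finset.sum_Ico_consecutive (fun i => dist (f i) (f (i + 1))) (Nat.zero_le q) hq
    have h6 := dist_triangle (f p) (f 0) (f q)
    rw [h, dist_comm (f q)] at h3
    rw [dist_comm (f 0)] at h2
    rw [Finset.range_eq_Ico, ← Real.dist_eq]
    linarith
  rcases le_total a b with hab | hab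
  · linarith [key a b hab hb, le_abs_self (f a - f b)]
  · have := key b a hab ha
    rw [abs_sub_comm] at this
    linarith [le_abs_self (f a - f b)]

def cr (x y : ℤ × ℤ) : ℤ := x.1 * y.2 - x.2 * y.1

theorem pr_iL (x : ℤ × ℤ) (θ : ℝ) : pr (iL x) θ
    = (2 * Real.cos θ) * x.1 + (Real.cos θ + Real.sqrt 3 * Real.sin θ) * x.2 := by
  simp [pr, iL]; ring

theorem poly_sup (N H : ℕ) (hH : H ≤ N) (hN : 0 < N) (d v : ℕ → ℤ × ℤ) (t : ℕ → ℤ)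
    (hd0 : d N = d 0) (hdH : d H = - d 0)
    (hv : ∀ j < N, v (j + 1) = v j + (t j * (d j).1, t j * (d j).2)) (hvN : v N = v 0)
    (hc : ∀ j < N, 0 < cr (d j) (d (j + 1))) (al be : ℝ) :
    ∃ j, j ≤ N ∧ ∀ z : ℤ × ℤ, (∀ j < N, 0 ≤ cr (d j) (z - v j)) →
      al * z.1 + be * z.2 ≤ al * (v j).1 + be * (v j).2 := by
  have hex : ∃ j < N, 0 ≤ al * (d j).1 + be * (d j).2 ∧ al * (d (j+1)).1 + be * (d (j+1)).2 ≤ 0 := by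
    by_contra hcon
    push Not at hcon
    have up : ∀ s, 0 ≤ al * (d s).1 + be * (d s).2 → ∀ r, s < r → r ≤ N → 0 < al * (d r).1 + be * (d r).2 := by
      intro s hs r hr
      induction r, hr using Nat.le_induction with
      | base => intro h; exact hcon s (by omega) hs
      | succ r hr ih => intro h; exact hcon r (by omega) (ih (by omega)).le
    have e1 : (d H).1 = - (d 0).1 := by rw [hdH]; rfl
    have e2 : (d H).2 = - (d 0).2 := by rw [hdH]; rfl
    rcases le_total 0 (al * (d 0).1 + be * (d 0).2) with h | h
    · have := up 0 h
      rcases Nat.eq_zero_or_pos H with h0 | h0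
      · have p := this N hN le_rfl
        rw [hd0] at p
        rw [h0] at e1 e2
        have a1 : (d 0).1 = 0 := by omega
        have a2 : (d 0).2 = 0 := by omega
        rw [a1, a2] at p
        simp at p
      · have p := this H h0 hH
        rw [e1, e2] at p; push_cast at p; linarith
    · have q : 0 ≤ al * (d H).1 + be * (d H).2 := by rw [e1, e2]; push_cast; linarith
      rcases Nat.lt_or_ge H N with h0 | h0
      · have p := up H q N h0 le_rfl
        rw [hd0] at p; linarith
      · have hHN : H = N := le_antisymm hH h0
        rw [hHN, hd0] at e1 e2
        have a1 : (d 0).1 = 0 := by omega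
        have a2 : (d 0).2 = 0 := by omega
        have := hc 0 hN
        simp [cr, a1, a2] at this
  obtain ⟨j, hj, h1, h2⟩ := hex
  refine ⟨j + 1, hj, fun z hz => ?_⟩
  have c1 := hz j hj
  have c2 : 0 ≤ cr (d (j + 1)) (z - v (j + 1)) := by
    rcases Nat.lt_or_ge (j + 1) N with h | h
    · exact hz _ h
    · have : j + 1 = N := by omega
      rw [this, hd0, hvN]; exact hz 0 hN
  have c3 : 0 ≤ cr (d j) (z - v (j + 1)) := by
    rw [hv j hj]
    simp only [cr, Prod.fst_sub, Prod.snd_sub, Prod.fst_add, Prod.snd_add] at c1 ⊢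
    linarith
  have c4 := hc j hj
  generalize d j = e at *
  generalize d (j + 1) = f at *
  generalize v (j + 1) = w at *
  simp only [cr, Prod.fst_sub, Prod.snd_sub] at c2 c3 c4
  have c2' : (0:ℝ) ≤ f.1 * (z.2 - w.2) - f.2 * (z.1 - w.1) := by exact_mod_cast c2
  have c3' : (0:ℝ) ≤ e.1 * (z.2 - w.2) - e.2 * (z.1 - w.1) := by exact_mod_cast c3
  have c4' : (0:ℝ) < e.1 * f.2 - e.2 * f.1 := by exact_mod_cast c4
  have key : (e.1 * f.2 - e.2 * f.1 : ℝ) * ((al * z.1 + be * z.2) - (al * w.1 + be * w.2)) =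
     - (f.1 * (z.2 - w.2) - f.2 * (z.1 - w.1)) * (al * e.1 + be * e.2) +
     (e.1 * (z.2 - w.2) - e.2 * (z.1 - w.1)) * (al * f.1 + be * f.2) := by ring
  by_contra hcon
  push Not at hcon
  have p1 := mul_pos c4' (sub_pos.2 hcon)
  have p2 := mul_nonneg c2' h1
  have p3 := mul_nonneg c3' (neg_nonneg.2 h2)
  linarith

theorem pr_pi (x : Pl) (θ : ℝ) : pr x (θ + Real.pi) = - pr x θ := by
  simp [pr]; ring

theorem Wd_half {ι : Type} [Fintype ι] [Nonempty ι] (c : ι → Pl) :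
    2 * Wd c = ∫ θ in (-Real.pi)..Real.pi, (Hs c θ + Hs c (θ + Real.pi)) := by
  have hcont := Hs_cont c
  have hc2 : Continuous fun θ => Hs c (θ + Real.pi) := hcont.comp (by fun_prop)
  rw [intervalIntegral.integral_add (hcont.intervalIntegrable _ _) (hc2.intervalIntegrable _ _),
    intervalIntegral.integral_comp_add_right (Hs c)]
  have := (Hs_periodic c).intervalIntegral_add_eq (-Real.pi) (-Real.pi + Real.pi)
  have e1 : -Real.pi + Real.pi + 2 * Real.pi = Real.pi + Real.pi := by ring
  have e2 : -Real.pi + 2 * Real.pi = Real.pi := by ring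
  rw [e1, e2] at this
  rw [← this, Wd]; ring

theorem poly_W {ι : Type} [Fintype ι] [Nonempty ι] (z : ι → ℤ × ℤ) (N H : ℕ) (hH : H ≤ N) (hN : 0 < N)
    (d v : ℕ → ℤ × ℤ) (t : ℕ → ℤ) (ht : ∀ j < N, 0 ≤ t j)
    (hd0 : d N = d 0) (hdH : d H = - d 0)
    (hv : ∀ j < N, v (j + 1) = v j + (t j * (d j).1, t j * (d j).2)) (hvN : v N = v 0)
    (hc : ∀ j < N, 0 < cr (d j) (d (j + 1)))
    (hz : ∀ i, ∀ j < N, 0 ≤ cr (d j) (z i - v j)) :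
    Wd (fun i => iL (z i)) ≤ ∑ j ∈ Finset.range N, t j * ‖iL (d j)‖ := by
  have key : ∀ θ, Hs (fun i => iL (z i)) θ + Hs (fun i => iL (z i)) (θ + Real.pi) ≤
      ∑ j ∈ Finset.range N, (t j / 2 : ℝ) * |pr (iL (d j)) θ| := by
    intro θ
    obtain ⟨a, ha, h1⟩ := poly_sup N H hH hN d v t hd0 hdH hv hvN hc (2 * Real.cos θ) (Real.cos θ + Real.sqrt 3 * Real.sin θ)
    obtain ⟨b, hb, h2⟩ := poly_sup N H hH hN d v t hd0 hdH hv hvN hc (2 * Real.cos (θ + Real.pi)) (Real.cos (θ + Real.pi) + Real.sqrt 3 * Real.sin (θ + Real.pi))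
    simp only [← pr_iL] at h1 h2
    have q1 : Hs (fun i => iL (z i)) θ ≤ pr (iL (v a)) θ := Hs_le _ _ _ fun i => h1 _ (hz i)
    have q2 : Hs (fun i => iL (z i)) (θ + Real.pi) ≤ pr (iL (v b)) (θ + Real.pi) := Hs_le _ _ _ fun i => h2 _ (hz i)
    rw [pr_pi] at q2
    have q3 := closed_var (fun j => pr (iL (v j)) θ) N a b ha hb (by simp only [hvN])
    have q4 : ∑ j ∈ Finset.range N, |pr (iL (v (j + 1))) θ - pr (iL (v j)) θ| =
        2 * ∑ j ∈ Finset.range N, (t j / 2 : ℝ) * |pr (iL (d j)) θ| := by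
      rw [Finset.mul_sum]
      apply Finset.sum_congr rfl
      intro j hj
      have hj' := Finset.mem_range.1 hj
      have : pr (iL (v (j + 1))) θ - pr (iL (v j)) θ = t j * pr (iL (d j)) θ := by
        rw [hv j hj', pr_iL, pr_iL, pr_iL]; simp; ring
      rw [this, abs_mul, abs_of_nonneg (by exact_mod_cast ht j hj')]; ring
    rw [q4] at q3
    linarith
  have h2 := Wd_half (fun i => iL (z i))
  have hcont := Hs_cont (fun i => iL (z i))
  have hc2 : Continuous fun θ => Hs (fun i => iL (z i)) (θ + Real.pi) := hcont.comp (by fun_prop)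
  have hc3 : ∀ j, Continuous fun θ => (t j / 2 : ℝ) * |pr (iL (d j)) θ| := fun j =>
    continuous_const.mul (pr_cont (iL (d j))).abs
  have hc4 : Continuous fun θ => ∑ j ∈ Finset.range N, (t j / 2 : ℝ) * |pr (iL (d j)) θ| :=
    continuous_finsetSum _ fun j _ => hc3 j
  have hle := intervalIntegral.integral_mono_on (μ := volume) (a := -Real.pi) (b := Real.pi) (by linarith [Real.pi_pos])
    ((hcont.add hc2).intervalIntegrable _ _) (hc4.intervalIntegrable _ _) (fun θ _ => key θ)
  have e0 : ∫ θ in (-Real.pi)..Real.pi, ∑ j ∈ Finset.range N, (t j / 2 : ℝ) * |pr (iL (d j)) θ|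
      = 2 * ∑ j ∈ Finset.range N, t j * ‖iL (d j)‖ := by
    rw [intervalIntegral.integral_finsetSum (fun j _ => (hc3 j).intervalIntegrable _ _), Finset.mul_sum]
    apply Finset.sum_congr rfl
    intro j _
    rw [intervalIntegral.integral_const_mul, int_abs_pr]; ring
  rw [e0] at hle
  simp only [Pi.add_apply] at hle
  linarith

def dirs (j : ℕ) : ℤ × ℤ := match j with
  | 0 => (1, 0)
  | 1 => (2, 1)
  | 2 => (1, 1)
  | 3 => (1, 2)
  | 4 => (0, 1)
  | 5 => (-1, 3)
  | 6 => (-1, 2)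
  | 7 => (-2, 3)
  | 8 => (-1, 1)
  | 9 => (-3, 2)
  | 10 => (-2, 1)
  | 11 => (-3, 1)
  | 12 => (-1, 0)
  | 13 => (-2, -1)
  | 14 => (-1, -1)
  | 15 => (-1, -2)
  | 16 => (0, -1)
  | 17 => (1, -3)
  | 18 => (1, -2)
  | 19 => (2, -3)
  | 20 => (1, -1)
  | 21 => (3, -2)
  | 22 => (2, -1)
  | 23 => (3, -1)
  | 24 => (1, 0)
  | _ => (0, 0)

def mults (X Y L M c1 c3 c5 c7 c9 c11 g0 g1 g2 g3 g4 g5 g6 g7 g8 g9 g10 g11 : ℕ) (j : ℕ) : ℤ := match j with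
  | 0 => (X:ℤ) - L - c1 - c11 - g0 - g1
  | 1 => g1
  | 2 => (c1:ℤ) - g1 - g2
  | 3 => g2
  | 4 => (Y:ℤ) - M - c1 - c3 - g2 - g3
  | 5 => g3
  | 6 => (c3:ℤ) - g3 - g4
  | 7 => g4
  | 8 => (M:ℤ) - c3 - c5 - g4 - g5
  | 9 => g5
  | 10 => (c5:ℤ) - g5 - g6
  | 11 => g6
  | 12 => (X:ℤ) - M - c5 - c7 - g6 - g7
  | 13 => g7
  | 14 => (c7:ℤ) - g7 - g8
  | 15 => g8
  | 16 => (Y:ℤ) - L - c7 - c9 - g8 - g9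
  | 17 => g9
  | 18 => (c9:ℤ) - g9 - g10
  | 19 => g10
  | 20 => (L:ℤ) - c9 - c11 - g10 - g11
  | 21 => g11
  | 22 => (c11:ℤ) - g11 - g0
  | 23 => g0
  | _ => 0

def verts (X Y L M c1 c3 c5 c7 c9 c11 g0 g1 g2 g3 g4 g5 g6 g7 g8 g9 g10 g11 : ℕ) (j : ℕ) : ℤ × ℤ := match j with
  | 0 => ((L:ℤ) + c11 + 1 * (g0:ℤ), 0)
  | 1 => ((X:ℤ) - c1 - 1 * (g1:ℤ), 0)
  | 2 => ((X:ℤ) - c1 + 1 * (g1:ℤ), 0 + 1 * (g1:ℤ))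
  | 3 => ((X:ℤ) - 1 * (g2:ℤ), (c1:ℤ) - 1 * (g2:ℤ))
  | 4 => ((X:ℤ), (c1:ℤ) + 1 * (g2:ℤ))
  | 5 => ((X:ℤ), (Y:ℤ) - M - c3 - 1 * (g3:ℤ))
  | 6 => ((X:ℤ) - 1 * (g3:ℤ), (Y:ℤ) - M - c3 + 2 * (g3:ℤ))
  | 7 => ((X:ℤ) - c3 + 1 * (g4:ℤ), (Y:ℤ) - M + c3 - 2 * (g4:ℤ))
  | 8 => ((X:ℤ) - c3 - 1 * (g4:ℤ), (Y:ℤ) - M + c3 + 1 * (g4:ℤ))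
  | 9 => ((X:ℤ) - M + c5 + 1 * (g5:ℤ), (Y:ℤ) - c5 - 1 * (g5:ℤ))
  | 10 => ((X:ℤ) - M + c5 - 2 * (g5:ℤ), (Y:ℤ) - c5 + 1 * (g5:ℤ))
  | 11 => ((X:ℤ) - M - c5 + 2 * (g6:ℤ), (Y:ℤ) - 1 * (g6:ℤ))
  | 12 => ((X:ℤ) - M - c5 - 1 * (g6:ℤ), (Y:ℤ))
  | 13 => ((c7:ℤ) + 1 * (g7:ℤ), (Y:ℤ))
  | 14 => ((c7:ℤ) - 1 * (g7:ℤ), (Y:ℤ) - 1 * (g7:ℤ))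
  | 15 => (0 + 1 * (g8:ℤ), (Y:ℤ) - c7 + 1 * (g8:ℤ))
  | 16 => (0, (Y:ℤ) - c7 - 1 * (g8:ℤ))
  | 17 => (0, (L:ℤ) + c9 + 1 * (g9:ℤ))
  | 18 => (0 + 1 * (g9:ℤ), (L:ℤ) + c9 - 2 * (g9:ℤ))
  | 19 => ((c9:ℤ) - 1 * (g10:ℤ), (L:ℤ) - c9 + 2 * (g10:ℤ))
  | 20 => ((c9:ℤ) + 1 * (g10:ℤ), (L:ℤ) - c9 - 1 * (g10:ℤ))
  | 21 => ((L:ℤ) - c11 - 1 * (g11:ℤ), (c11:ℤ) + 1 * (g11:ℤ))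
  | 22 => ((L:ℤ) - c11 + 2 * (g11:ℤ), (c11:ℤ) - 1 * (g11:ℤ))
  | 23 => ((L:ℤ) + c11 - 2 * (g0:ℤ), 0 + 1 * (g0:ℤ))
  | 24 => ((L:ℤ) + c11 + 1 * (g0:ℤ), 0)
  | _ => (0, 0)

theorem corner_aux (s r g : ℤ) (hs : 0 ≤ s) (hr : 0 ≤ r) (hg : g ≤ 1)
    (h : s = 0 → r = 0 → ¬ 0 < g) : g ≤ s + r := by
  by_contra hc
  exact h (by omega) (by omega) (by omega)

theorem exists_filter (B : Finset (ℤ × ℤ)) (Q : ℤ × ℤ → Prop) :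
    ∃ F : Finset (ℤ × ℤ), ∀ p, p ∈ F ↔ p ∈ B ∧ Q p := by
  classical
  exact ⟨B.filter Q, fun p => Finset.mem_filter⟩

theorem iL_norm (z : ℤ × ℤ) (q : ℕ) (h : z.1 ^ 2 + z.1 * z.2 + z.2 ^ 2 = q) : ‖iL z‖ = 2 * Real.sqrt q := by
  rw [← sq_eq_sq₀ (norm_nonneg _) (by positivity), iL_nsq, h, mul_pow, Real.sq_sqrt (by positivity)]
  push_cast; ring

set_option maxHeartbeats 2000000 in
theorem poly_count (X Y L M c1 c3 c5 c7 c9 c11 g0 g1 g2 g3 g4 g5 g6 g7 g8 g9 g10 g11 : ℕ) (hg0 : g0 ≤ 1) (hg1 : g1 ≤ 1) (hg2 : g2 ≤ 1) (hg3 : g3 ≤ 1) (hg4 : g4 ≤ 1) (hg5 : g5 ≤ 1) (hg6 : g6 ≤ 1) (hg7 : g7 ≤ 1) (hg8 : g8 ≤ 1) (hg9 : g9 ≤ 1) (hg10 : g10 ≤ 1) (hg11 : g11 ≤ 1)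
    (F : Finset (ℤ × ℤ)) (hF : ∀ p : ℤ × ℤ, 0 ≤ p.1 → p.1 ≤ X → 0 ≤ p.2 → p.2 ≤ Y →
      (∀ j < 24, 0 ≤ cr (dirs j) (p - verts X Y L M c1 c3 c5 c7 c9 c11 g0 g1 g2 g3 g4 g5 g6 g7 g8 g9 g10 g11 j)) → p ∈ F) :
    2 * ((X + 1) * (Y + 1)) ≤ 2 * F.card + L * (L + 1) + M * (M + 1) + c1 * (c1 + 1) + c3 * (c3 + 1) + c5 * (c5 + 1)
      + c7 * (c7 + 1) + c9 * (c9 + 1) + c11 * (c11 + 1) + 2 * (g0 + g1 + g2 + g3 + g4 + g5 + g6 + g7 + g8 + g9 + g10 + g11) := by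
  set tL : Finset (ℤ × ℤ) := tri L (fun i j => (i, j)) with htL
  set tM : Finset (ℤ × ℤ) := tri M (fun i j => ((X:ℤ) - i, (Y:ℤ) - j)) with htM
  set tc1 : Finset (ℤ × ℤ) := tri c1 (fun i j => ((X:ℤ) - i, j)) with htc1
  set tc3 : Finset (ℤ × ℤ) := tri c3 (fun i j => ((X:ℤ) - i, (Y:ℤ) - M + i - j)) with htc3
  set tc5 : Finset (ℤ × ℤ) := tri c5 (fun i j => ((X:ℤ) - M + i - j, (Y:ℤ) - i)) with htc5
  set tc7 : Finset (ℤ × ℤ) := tri c7 (fun i j => (i, (Y:ℤ) - j)) with htc7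
  set tc9 : Finset (ℤ × ℤ) := tri c9 (fun i j => (i, (L:ℤ) - i + j)) with htc9
  set tc11 : Finset (ℤ × ℤ) := tri c11 (fun i j => ((L:ℤ) - i + j, i)) with htc11
  set r0 : Finset (ℤ × ℤ) := ((Finset.range g0).image fun _ => (((L:ℤ) + c11, 0) : ℤ × ℤ)) with hr0
  set r1 : Finset (ℤ × ℤ) := ((Finset.range g1).image fun _ => (((X:ℤ) - c1, 0) : ℤ × ℤ)) with hr1
  set r2 : Finset (ℤ × ℤ) := ((Finset.range g2).image fun _ => (((X:ℤ), (c1:ℤ)) : ℤ × ℤ)) with hr2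
  set r3 : Finset (ℤ × ℤ) := ((Finset.range g3).image fun _ => (((X:ℤ), (Y:ℤ) - M - c3) : ℤ × ℤ)) with hr3
  set r4 : Finset (ℤ × ℤ) := ((Finset.range g4).image fun _ => (((X:ℤ) - c3, (Y:ℤ) - M + c3) : ℤ × ℤ)) with hr4
  set r5 : Finset (ℤ × ℤ) := ((Finset.range g5).image fun _ => (((X:ℤ) - M + c5, (Y:ℤ) - c5) : ℤ × ℤ)) with hr5
  set r6 : Finset (ℤ × ℤ) := ((Finset.range g6).image fun _ => (((X:ℤ) - M - c5, (Y:ℤ)) : ℤ × ℤ)) with hr6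
  set r7 : Finset (ℤ × ℤ) := ((Finset.range g7).image fun _ => (((c7:ℤ), (Y:ℤ)) : ℤ × ℤ)) with hr7
  set r8 : Finset (ℤ × ℤ) := ((Finset.range g8).image fun _ => ((0, (Y:ℤ) - c7) : ℤ × ℤ)) with hr8
  set r9 : Finset (ℤ × ℤ) := ((Finset.range g9).image fun _ => ((0, (L:ℤ) + c9) : ℤ × ℤ)) with hr9
  set r10 : Finset (ℤ × ℤ) := ((Finset.range g10).image fun _ => (((c9:ℤ), (L:ℤ) - c9) : ℤ × ℤ)) with hr10
  set r11 : Finset (ℤ × ℤ) := ((Finset.range g11).image fun _ => (((L:ℤ) - c11, (c11:ℤ)) : ℤ × ℤ)) with hr11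
  have hsub : (Finset.Icc (0:ℤ) X) ×ˢ (Finset.Icc (0:ℤ) Y) ⊆ F ∪ (tL ∪ (tM ∪ (tc1 ∪ (tc3 ∪ (tc5 ∪ (tc7 ∪ (tc9 ∪ (tc11 ∪ (r0 ∪ (r1 ∪ (r2 ∪ (r3 ∪ (r4 ∪ (r5 ∪ (r6 ∪ (r7 ∪ (r8 ∪ (r9 ∪ (r10 ∪ (r11)))))))))))))))))))) := by
    intro p hp
    simp only [Finset.mem_product, Finset.mem_Icc] at hp
    obtain ⟨⟨b8, b2⟩, b0, b6⟩ := hp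
    by_contra hcon
    simp only [Finset.mem_union, not_or] at hcon
    obtain ⟨nF, ntL, ntM, ntc1, ntc3, ntc5, ntc7, ntc9, ntc11, nr0, nr1, nr2, nr3, nr4, nr5, nr6, nr7, nr8, nr9, nr10, nr11⟩ := hcon
    have qL : (L:ℤ) ≤ p.1 + p.2 := by
      by_contra hc
      exact ntL ((tri_mem _ _ _).2 ⟨p.1, p.2, by omega, by omega, by omega, Prod.ext (by first | rfl | (dsimp only; ring)) (by first | rfl | (dsimp only; ring))⟩)
    have qM : p.1 + p.2 ≤ X + Y - M := by
      by_contra hc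
      exact ntM ((tri_mem _ _ _).2 ⟨X - p.1, Y - p.2, by omega, by omega, by omega, Prod.ext (by first | rfl | (dsimp only; ring)) (by first | rfl | (dsimp only; ring))⟩)
    have qc1 : p.1 - p.2 ≤ X - c1 := by
      by_contra hc
      exact ntc1 ((tri_mem _ _ _).2 ⟨X - p.1, p.2, by omega, by omega, by omega, Prod.ext (by first | rfl | (dsimp only; ring)) (by first | rfl | (dsimp only; ring))⟩)
    have qc3 : 2 * p.1 + p.2 ≤ 2 * X + Y - M - c3 := by
      by_contra hc
      exact ntc3 ((tri_mem _ _ _).2 ⟨X - p.1, X + Y - M - p.1 - p.2, by omega, by omega, by omega, Prod.ext (by first | rfl | (dsimp only; ring)) (by first | rfl | (dsimp only; ring))⟩)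
    have qc5 : p.1 + 2 * p.2 ≤ X + 2 * Y - M - c5 := by
      by_contra hc
      exact ntc5 ((tri_mem _ _ _).2 ⟨Y - p.2, X + Y - M - p.1 - p.2, by omega, by omega, by omega, Prod.ext (by first | rfl | (dsimp only; ring)) (by first | rfl | (dsimp only; ring))⟩)
    have qc7 : p.2 - p.1 ≤ Y - c7 := by
      by_contra hc
      exact ntc7 ((tri_mem _ _ _).2 ⟨p.1, Y - p.2, by omega, by omega, by omega, Prod.ext (by first | rfl | (dsimp only; ring)) (by first | rfl | (dsimp only; ring))⟩)
    have qc9 : (L:ℤ) + c9 ≤ 2 * p.1 + p.2 := by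
      by_contra hc
      exact ntc9 ((tri_mem _ _ _).2 ⟨p.1, p.1 + p.2 - L, by omega, by omega, by omega, Prod.ext (by first | rfl | (dsimp only; ring)) (by first | rfl | (dsimp only; ring))⟩)
    have qc11 : (L:ℤ) + c11 ≤ p.1 + 2 * p.2 := by
      by_contra hc
      exact ntc11 ((tri_mem _ _ _).2 ⟨p.2, p.1 + p.2 - L, by omega, by omega, by omega, Prod.ext (by first | rfl | (dsimp only; ring)) (by first | rfl | (dsimp only; ring))⟩)
    have s0 : 0 ≤ (1) * (p.2 - (0)) - (0) * (p.1 - ((L:ℤ) + c11)) := by linarith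
    have s1 : 0 ≤ (1) * (p.2 - (0)) - (1) * (p.1 - ((X:ℤ) - c1)) := by linarith
    have s2 : 0 ≤ (0) * (p.2 - ((c1:ℤ))) - (1) * (p.1 - ((X:ℤ))) := by linarith
    have s3 : 0 ≤ (-1) * (p.2 - ((Y:ℤ) - M - c3)) - (2) * (p.1 - ((X:ℤ))) := by linarith
    have s4 : 0 ≤ (-1) * (p.2 - ((Y:ℤ) - M + c3)) - (1) * (p.1 - ((X:ℤ) - c3)) := by linarith
    have s5 : 0 ≤ (-2) * (p.2 - ((Y:ℤ) - c5)) - (1) * (p.1 - ((X:ℤ) - M + c5)) := by linarith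
    have s6 : 0 ≤ (-1) * (p.2 - ((Y:ℤ))) - (0) * (p.1 - ((X:ℤ) - M - c5)) := by linarith
    have s7 : 0 ≤ (-1) * (p.2 - ((Y:ℤ))) - (-1) * (p.1 - ((c7:ℤ))) := by linarith
    have s8 : 0 ≤ (0) * (p.2 - ((Y:ℤ) - c7)) - (-1) * (p.1 - (0)) := by linarith
    have s9 : 0 ≤ (1) * (p.2 - ((L:ℤ) + c9)) - (-2) * (p.1 - (0)) := by linarith
    have s10 : 0 ≤ (1) * (p.2 - ((L:ℤ) - c9)) - (-1) * (p.1 - ((c9:ℤ))) := by linarith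
    have s11 : 0 ≤ (2) * (p.2 - ((c11:ℤ))) - (-1) * (p.1 - ((L:ℤ) - c11)) := by linarith
    have k0 := corner_aux ((2) * (p.2 - (0)) - (-1) * (p.1 - ((L:ℤ) + c11))) ((1) * (p.2 - (0)) - (0) * (p.1 - ((L:ℤ) + c11))) g0 (by linarith) (by linarith)
      (by exact_mod_cast hg0) (fun h1 h2 h3 => nr0 (Finset.mem_image.2 ⟨0, Finset.mem_range.2 (by exact_mod_cast h3),
        Prod.ext (by dsimp only; linarith) (by dsimp only; linarith)⟩))
    have k1 := corner_aux ((1) * (p.2 - (0)) - (0) * (p.1 - ((X:ℤ) - c1))) ((1) * (p.2 - (0)) - (1) * (p.1 - ((X:ℤ) - c1))) g1 (by linarith) (by linarith)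
      (by exact_mod_cast hg1) (fun h1 h2 h3 => nr1 (Finset.mem_image.2 ⟨0, Finset.mem_range.2 (by exact_mod_cast h3),
        Prod.ext (by dsimp only; linarith) (by dsimp only; linarith)⟩))
    have k2 := corner_aux ((1) * (p.2 - ((c1:ℤ))) - (1) * (p.1 - ((X:ℤ)))) ((0) * (p.2 - ((c1:ℤ))) - (1) * (p.1 - ((X:ℤ)))) g2 (by linarith) (by linarith)
      (by exact_mod_cast hg2) (fun h1 h2 h3 => nr2 (Finset.mem_image.2 ⟨0, Finset.mem_range.2 (by exact_mod_cast h3),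
        Prod.ext (by dsimp only; linarith) (by dsimp only; linarith)⟩))
    have k3 := corner_aux ((0) * (p.2 - ((Y:ℤ) - M - c3)) - (1) * (p.1 - ((X:ℤ)))) ((-1) * (p.2 - ((Y:ℤ) - M - c3)) - (2) * (p.1 - ((X:ℤ)))) g3 (by linarith) (by linarith)
      (by exact_mod_cast hg3) (fun h1 h2 h3 => nr3 (Finset.mem_image.2 ⟨0, Finset.mem_range.2 (by exact_mod_cast h3),
        Prod.ext (by dsimp only; linarith) (by dsimp only; linarith)⟩))
    have k4 := corner_aux ((-1) * (p.2 - ((Y:ℤ) - M + c3)) - (2) * (p.1 - ((X:ℤ) - c3))) ((-1) * (p.2 - ((Y:ℤ) - M + c3)) - (1) * (p.1 - ((X:ℤ) - c3))) g4 (by linarith) (by linarith)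
      (by exact_mod_cast hg4) (fun h1 h2 h3 => nr4 (Finset.mem_image.2 ⟨0, Finset.mem_range.2 (by exact_mod_cast h3),
        Prod.ext (by dsimp only; linarith) (by dsimp only; linarith)⟩))
    have k5 := corner_aux ((-1) * (p.2 - ((Y:ℤ) - c5)) - (1) * (p.1 - ((X:ℤ) - M + c5))) ((-2) * (p.2 - ((Y:ℤ) - c5)) - (1) * (p.1 - ((X:ℤ) - M + c5))) g5 (by linarith) (by linarith)
      (by exact_mod_cast hg5) (fun h1 h2 h3 => nr5 (Finset.mem_image.2 ⟨0, Finset.mem_range.2 (by exact_mod_cast h3),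
        Prod.ext (by dsimp only; linarith) (by dsimp only; linarith)⟩))
    have k6 := corner_aux ((-2) * (p.2 - ((Y:ℤ))) - (1) * (p.1 - ((X:ℤ) - M - c5))) ((-1) * (p.2 - ((Y:ℤ))) - (0) * (p.1 - ((X:ℤ) - M - c5))) g6 (by linarith) (by linarith)
      (by exact_mod_cast hg6) (fun h1 h2 h3 => nr6 (Finset.mem_image.2 ⟨0, Finset.mem_range.2 (by exact_mod_cast h3),
        Prod.ext (by dsimp only; linarith) (by dsimp only; linarith)⟩))
    have k7 := corner_aux ((-1) * (p.2 - ((Y:ℤ))) - (0) * (p.1 - ((c7:ℤ)))) ((-1) * (p.2 - ((Y:ℤ))) - (-1) * (p.1 - ((c7:ℤ)))) g7 (by linarith) (by linarith)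
      (by exact_mod_cast hg7) (fun h1 h2 h3 => nr7 (Finset.mem_image.2 ⟨0, Finset.mem_range.2 (by exact_mod_cast h3),
        Prod.ext (by dsimp only; linarith) (by dsimp only; linarith)⟩))
    have k8 := corner_aux ((-1) * (p.2 - ((Y:ℤ) - c7)) - (-1) * (p.1 - (0))) ((0) * (p.2 - ((Y:ℤ) - c7)) - (-1) * (p.1 - (0))) g8 (by linarith) (by linarith)
      (by exact_mod_cast hg8) (fun h1 h2 h3 => nr8 (Finset.mem_image.2 ⟨0, Finset.mem_range.2 (by exact_mod_cast h3),
        Prod.ext (by dsimp only; linarith) (by dsimp only; linarith)⟩))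
    have k9 := corner_aux ((0) * (p.2 - ((L:ℤ) + c9)) - (-1) * (p.1 - (0))) ((1) * (p.2 - ((L:ℤ) + c9)) - (-2) * (p.1 - (0))) g9 (by linarith) (by linarith)
      (by exact_mod_cast hg9) (fun h1 h2 h3 => nr9 (Finset.mem_image.2 ⟨0, Finset.mem_range.2 (by exact_mod_cast h3),
        Prod.ext (by dsimp only; linarith) (by dsimp only; linarith)⟩))
    have k10 := corner_aux ((1) * (p.2 - ((L:ℤ) - c9)) - (-2) * (p.1 - ((c9:ℤ)))) ((1) * (p.2 - ((L:ℤ) - c9)) - (-1) * (p.1 - ((c9:ℤ)))) g10 (by linarith) (by linarith)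
      (by exact_mod_cast hg10) (fun h1 h2 h3 => nr10 (Finset.mem_image.2 ⟨0, Finset.mem_range.2 (by exact_mod_cast h3),
        Prod.ext (by dsimp only; linarith) (by dsimp only; linarith)⟩))
    have k11 := corner_aux ((1) * (p.2 - ((c11:ℤ))) - (-1) * (p.1 - ((L:ℤ) - c11))) ((2) * (p.2 - ((c11:ℤ))) - (-1) * (p.1 - ((L:ℤ) - c11))) g11 (by linarith) (by linarith)
      (by exact_mod_cast hg11) (fun h1 h2 h3 => nr11 (Finset.mem_image.2 ⟨0, Finset.mem_range.2 (by exact_mod_cast h3),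
        Prod.ext (by dsimp only; linarith) (by dsimp only; linarith)⟩))
    refine nF (hF p b8 b2 b0 b6 fun j hj => ?_)
    interval_cases j <;> simp only [cr, dirs, verts, Prod.fst_sub, Prod.snd_sub] <;> linarith
  have hcard := Finset.card_le_card hsub
  rw [Finset.card_product, Int.card_Icc, Int.card_Icc] at hcard
  have ex : ((X:ℤ) + 1 - 0).toNat = X + 1 := by omega
  have ey : ((Y:ℤ) + 1 - 0).toNat = Y + 1 := by omega
  rw [ex, ey] at hcard
  have aL : 2 * tL.card = _ := tri_card L _ (fun i j i' j' h => by simp only [Prod.mk.injEq] at h; omega)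
  have aM : 2 * tM.card = _ := tri_card M _ (fun i j i' j' h => by simp only [Prod.mk.injEq] at h; omega)
  have ac1 : 2 * tc1.card = _ := tri_card c1 _ (fun i j i' j' h => by simp only [Prod.mk.injEq] at h; omega)
  have ac3 : 2 * tc3.card = _ := tri_card c3 _ (fun i j i' j' h => by simp only [Prod.mk.injEq] at h; omega)
  have ac5 : 2 * tc5.card = _ := tri_card c5 _ (fun i j i' j' h => by simp only [Prod.mk.injEq] at h; omega)
  have ac7 : 2 * tc7.card = _ := tri_card c7 _ (fun i j i' j' h => by simp only [Prod.mk.injEq] at h; omega)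
  have ac9 : 2 * tc9.card = _ := tri_card c9 _ (fun i j i' j' h => by simp only [Prod.mk.injEq] at h; omega)
  have ac11 : 2 * tc11.card = _ := tri_card c11 _ (fun i j i' j' h => by simp only [Prod.mk.injEq] at h; omega)
  have w0 : r0.card ≤ g0 := Finset.card_image_le.trans (by rw [Finset.card_range])
  have w1 : r1.card ≤ g1 := Finset.card_image_le.trans (by rw [Finset.card_range])
  have w2 : r2.card ≤ g2 := Finset.card_image_le.trans (by rw [Finset.card_range])
  have w3 : r3.card ≤ g3 := Finset.card_image_le.trans (by rw [Finset.card_range])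
  have w4 : r4.card ≤ g4 := Finset.card_image_le.trans (by rw [Finset.card_range])
  have w5 : r5.card ≤ g5 := Finset.card_image_le.trans (by rw [Finset.card_range])
  have w6 : r6.card ≤ g6 := Finset.card_image_le.trans (by rw [Finset.card_range])
  have w7 : r7.card ≤ g7 := Finset.card_image_le.trans (by rw [Finset.card_range])
  have w8 : r8.card ≤ g8 := Finset.card_image_le.trans (by rw [Finset.card_range])
  have w9 : r9.card ≤ g9 := Finset.card_image_le.trans (by rw [Finset.card_range])
  have w10 : r10.card ≤ g10 := Finset.card_image_le.trans (by rw [Finset.card_range])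
  have w11 : r11.card ≤ g11 := Finset.card_image_le.trans (by rw [Finset.card_range])
  have u0 := Finset.card_union_le F (tL ∪ (tM ∪ (tc1 ∪ (tc3 ∪ (tc5 ∪ (tc7 ∪ (tc9 ∪ (tc11 ∪ (r0 ∪ (r1 ∪ (r2 ∪ (r3 ∪ (r4 ∪ (r5 ∪ (r6 ∪ (r7 ∪ (r8 ∪ (r9 ∪ (r10 ∪ (r11))))))))))))))))))))
  have u1 := Finset.card_union_le tL (tM ∪ (tc1 ∪ (tc3 ∪ (tc5 ∪ (tc7 ∪ (tc9 ∪ (tc11 ∪ (r0 ∪ (r1 ∪ (r2 ∪ (r3 ∪ (r4 ∪ (r5 ∪ (r6 ∪ (r7 ∪ (r8 ∪ (r9 ∪ (r10 ∪ (r11)))))))))))))))))))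
  have u2 := Finset.card_union_le tM (tc1 ∪ (tc3 ∪ (tc5 ∪ (tc7 ∪ (tc9 ∪ (tc11 ∪ (r0 ∪ (r1 ∪ (r2 ∪ (r3 ∪ (r4 ∪ (r5 ∪ (r6 ∪ (r7 ∪ (r8 ∪ (r9 ∪ (r10 ∪ (r11))))))))))))))))))
  have u3 := Finset.card_union_le tc1 (tc3 ∪ (tc5 ∪ (tc7 ∪ (tc9 ∪ (tc11 ∪ (r0 ∪ (r1 ∪ (r2 ∪ (r3 ∪ (r4 ∪ (r5 ∪ (r6 ∪ (r7 ∪ (r8 ∪ (r9 ∪ (r10 ∪ (r11)))))))))))))))))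
  have u4 := Finset.card_union_le tc3 (tc5 ∪ (tc7 ∪ (tc9 ∪ (tc11 ∪ (r0 ∪ (r1 ∪ (r2 ∪ (r3 ∪ (r4 ∪ (r5 ∪ (r6 ∪ (r7 ∪ (r8 ∪ (r9 ∪ (r10 ∪ (r11))))))))))))))))
  have u5 := Finset.card_union_le tc5 (tc7 ∪ (tc9 ∪ (tc11 ∪ (r0 ∪ (r1 ∪ (r2 ∪ (r3 ∪ (r4 ∪ (r5 ∪ (r6 ∪ (r7 ∪ (r8 ∪ (r9 ∪ (r10 ∪ (r11)))))))))))))))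
  have u6 := Finset.card_union_le tc7 (tc9 ∪ (tc11 ∪ (r0 ∪ (r1 ∪ (r2 ∪ (r3 ∪ (r4 ∪ (r5 ∪ (r6 ∪ (r7 ∪ (r8 ∪ (r9 ∪ (r10 ∪ (r11))))))))))))))
  have u7 := Finset.card_union_le tc9 (tc11 ∪ (r0 ∪ (r1 ∪ (r2 ∪ (r3 ∪ (r4 ∪ (r5 ∪ (r6 ∪ (r7 ∪ (r8 ∪ (r9 ∪ (r10 ∪ (r11)))))))))))))
  have u8 := Finset.card_union_le tc11 (r0 ∪ (r1 ∪ (r2 ∪ (r3 ∪ (r4 ∪ (r5 ∪ (r6 ∪ (r7 ∪ (r8 ∪ (r9 ∪ (r10 ∪ (r11))))))))))))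
  have u9 := Finset.card_union_le r0 (r1 ∪ (r2 ∪ (r3 ∪ (r4 ∪ (r5 ∪ (r6 ∪ (r7 ∪ (r8 ∪ (r9 ∪ (r10 ∪ (r11)))))))))))
  have u10 := Finset.card_union_le r1 (r2 ∪ (r3 ∪ (r4 ∪ (r5 ∪ (r6 ∪ (r7 ∪ (r8 ∪ (r9 ∪ (r10 ∪ (r11))))))))))
  have u11 := Finset.card_union_le r2 (r3 ∪ (r4 ∪ (r5 ∪ (r6 ∪ (r7 ∪ (r8 ∪ (r9 ∪ (r10 ∪ (r11)))))))))
  have u12 := Finset.card_union_le r3 (r4 ∪ (r5 ∪ (r6 ∪ (r7 ∪ (r8 ∪ (r9 ∪ (r10 ∪ (r11))))))))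
  have u13 := Finset.card_union_le r4 (r5 ∪ (r6 ∪ (r7 ∪ (r8 ∪ (r9 ∪ (r10 ∪ (r11)))))))
  have u14 := Finset.card_union_le r5 (r6 ∪ (r7 ∪ (r8 ∪ (r9 ∪ (r10 ∪ (r11))))))
  have u15 := Finset.card_union_le r6 (r7 ∪ (r8 ∪ (r9 ∪ (r10 ∪ (r11)))))
  have u16 := Finset.card_union_le r7 (r8 ∪ (r9 ∪ (r10 ∪ (r11))))
  have u17 := Finset.card_union_le r8 (r9 ∪ (r10 ∪ (r11)))
  have u18 := Finset.card_union_le r9 (r10 ∪ (r11))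
  have u19 := Finset.card_union_le r10 (r11)
  clear_value tL tM tc1 tc3 tc5 tc7 tc9 tc11 r0 r1 r2 r3 r4 r5 r6 r7 r8 r9 r10 r11
  generalize (X + 1) * (Y + 1) = XY at *
  linarith

set_option maxHeartbeats 2000000 in
theorem polygon (n : ℕ) (hn : 0 < n) (X Y L M c1 c3 c5 c7 c9 c11 g0 g1 g2 g3 g4 g5 g6 g7 g8 g9 g10 g11 : ℕ) (hg0 : g0 ≤ 1) (hg1 : g1 ≤ 1) (hg2 : g2 ≤ 1) (hg3 : g3 ≤ 1) (hg4 : g4 ≤ 1) (hg5 : g5 ≤ 1) (hg6 : g6 ≤ 1) (hg7 : g7 ≤ 1) (hg8 : g8 ≤ 1) (hg9 : g9 ≤ 1) (hg10 : g10 ≤ 1) (hg11 : g11 ≤ 1)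
    (ht0 : g0 + g1 + L + c1 + c11 ≤ X)
    (ht1 : g1 + g2 ≤ c1)
    (ht2 : g2 + g3 + M + c1 + c3 ≤ Y)
    (ht3 : g3 + g4 ≤ c3)
    (ht4 : g4 + g5 + c3 + c5 ≤ M)
    (ht5 : g5 + g6 ≤ c5)
    (ht6 : g6 + g7 + M + c5 + c7 ≤ X)
    (ht7 : g7 + g8 ≤ c7)
    (ht8 : g8 + g9 + L + c7 + c9 ≤ Y)
    (ht9 : g9 + g10 ≤ c9)
    (ht10 : g10 + g11 + c9 + c11 ≤ L)
    (ht11 : g11 + g0 ≤ c11)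
    (m k G : ℕ) (hm : m + L + M = 2 * X + 2 * Y) (hk : k = c1 + c3 + c5 + c7 + c9 + c11)
    (hG : G = g0 + g1 + g2 + g3 + g4 + g5 + g6 + g7 + g8 + g9 + g10 + g11)
    (hcount : 2 * n + L * (L + 1) + M * (M + 1) + c1 * (c1 + 1) + c3 * (c3 + 1) + c5 * (c5 + 1)
      + c7 * (c7 + 1) + c9 * (c9 + 1) + c11 * (c11 + 1) + 2 * G ≤ 2 * ((X + 1) * (Y + 1))) :
    ∃ c' : Fin n → Pl, Packing c' ∧
      Wd c' ≤ 2 * (m - (2 - √3) * k - (1 + √3 - √7) * G) := by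
  have : Nonempty (Fin n) := ⟨⟨0, hn⟩⟩
  obtain ⟨F, hF⟩ : ∃ F : Finset (ℤ × ℤ), ∀ p, p ∈ F ↔ ((0 ≤ p.1 ∧ p.1 ≤ X ∧ 0 ≤ p.2 ∧ p.2 ≤ Y) ∧
      ∀ j < 24, 0 ≤ cr (dirs j) (p - verts X Y L M c1 c3 c5 c7 c9 c11 g0 g1 g2 g3 g4 g5 g6 g7 g8 g9 g10 g11 j)) := by
    obtain ⟨F, hF⟩ := exists_filter ((Finset.Icc (0:ℤ) X) ×ˢ (Finset.Icc (0:ℤ) Y))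
      (fun p => ∀ j < 24, 0 ≤ cr (dirs j) (p - verts X Y L M c1 c3 c5 c7 c9 c11 g0 g1 g2 g3 g4 g5 g6 g7 g8 g9 g10 g11 j))
    refine ⟨F, fun p => ?_⟩
    rw [hF, Finset.mem_product, Finset.mem_Icc, Finset.mem_Icc]
    tauto
  have hc := poly_count X Y L M c1 c3 c5 c7 c9 c11 g0 g1 g2 g3 g4 g5 g6 g7 g8 g9 g10 g11 hg0 hg1 hg2 hg3 hg4 hg5 hg6 hg7 hg8 hg9 hg10 hg11 F
    (fun p h1 h2 h3 h4 h5 => (hF p).2 ⟨⟨h1, h2, h3, h4⟩, h5⟩)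
  have hle : n ≤ F.card := by rw [hG] at hcount; linarith
  set z : Fin n → ℤ × ℤ := fun i => (F.equivFin.symm (Fin.castLE hle i) : ℤ × ℤ) with hzdef
  have hzi : Function.Injective z := fun a b hab =>
    Fin.castLE_injective hle (F.equivFin.symm.injective (Subtype.ext hab))
  have hzF : ∀ i, ∀ j < 24, 0 ≤ cr (dirs j) (z i - verts X Y L M c1 c3 c5 c7 c9 c11 g0 g1 g2 g3 g4 g5 g6 g7 g8 g9 g10 g11 j) := fun i =>
    ((hF _).1 (F.equivFin.symm (Fin.castLE hle i)).2).2
  refine ⟨fun i => iL (z i), iL_packing z hzi, ?_⟩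
  have hW := poly_W z 24 12 (by norm_num) (by norm_num) dirs (verts X Y L M c1 c3 c5 c7 c9 c11 g0 g1 g2 g3 g4 g5 g6 g7 g8 g9 g10 g11) (mults X Y L M c1 c3 c5 c7 c9 c11 g0 g1 g2 g3 g4 g5 g6 g7 g8 g9 g10 g11)
    (by intro j hj; interval_cases j <;> simp only [mults] <;> omega)
    rfl rfl
    (by intro j hj; interval_cases j <;> simp only [mults, dirs, verts] <;> refine Prod.ext ?_ ?_ <;> simp only [Prod.fst_add, Prod.snd_add] <;> ring)
    rfl
    (by intro j hj; interval_cases j <;> decide)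
    hzF
  refine hW.trans (le_of_eq ?_)
  simp only [Finset.sum_range_succ, Finset.sum_range_zero, zero_add]
  have l0 : ‖iL (dirs 0)‖ = 2 * √(1:ℕ) := iL_norm _ _ (by decide)
  have l1 : ‖iL (dirs 1)‖ = 2 * √(7:ℕ) := iL_norm _ _ (by decide)
  have l2 : ‖iL (dirs 2)‖ = 2 * √(3:ℕ) := iL_norm _ _ (by decide)
  have l3 : ‖iL (dirs 3)‖ = 2 * √(7:ℕ) := iL_norm _ _ (by decide)
  have l4 : ‖iL (dirs 4)‖ = 2 * √(1:ℕ) := iL_norm _ _ (by decide)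
  have l5 : ‖iL (dirs 5)‖ = 2 * √(7:ℕ) := iL_norm _ _ (by decide)
  have l6 : ‖iL (dirs 6)‖ = 2 * √(3:ℕ) := iL_norm _ _ (by decide)
  have l7 : ‖iL (dirs 7)‖ = 2 * √(7:ℕ) := iL_norm _ _ (by decide)
  have l8 : ‖iL (dirs 8)‖ = 2 * √(1:ℕ) := iL_norm _ _ (by decide)
  have l9 : ‖iL (dirs 9)‖ = 2 * √(7:ℕ) := iL_norm _ _ (by decide)
  have l10 : ‖iL (dirs 10)‖ = 2 * √(3:ℕ) := iL_norm _ _ (by decide)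
  have l11 : ‖iL (dirs 11)‖ = 2 * √(7:ℕ) := iL_norm _ _ (by decide)
  have l12 : ‖iL (dirs 12)‖ = 2 * √(1:ℕ) := iL_norm _ _ (by decide)
  have l13 : ‖iL (dirs 13)‖ = 2 * √(7:ℕ) := iL_norm _ _ (by decide)
  have l14 : ‖iL (dirs 14)‖ = 2 * √(3:ℕ) := iL_norm _ _ (by decide)
  have l15 : ‖iL (dirs 15)‖ = 2 * √(7:ℕ) := iL_norm _ _ (by decide)
  have l16 : ‖iL (dirs 16)‖ = 2 * √(1:ℕ) := iL_norm _ _ (by decide)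
  have l17 : ‖iL (dirs 17)‖ = 2 * √(7:ℕ) := iL_norm _ _ (by decide)
  have l18 : ‖iL (dirs 18)‖ = 2 * √(3:ℕ) := iL_norm _ _ (by decide)
  have l19 : ‖iL (dirs 19)‖ = 2 * √(7:ℕ) := iL_norm _ _ (by decide)
  have l20 : ‖iL (dirs 20)‖ = 2 * √(1:ℕ) := iL_norm _ _ (by decide)
  have l21 : ‖iL (dirs 21)‖ = 2 * √(7:ℕ) := iL_norm _ _ (by decide)
  have l22 : ‖iL (dirs 22)‖ = 2 * √(3:ℕ) := iL_norm _ _ (by decide)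
  have l23 : ‖iL (dirs 23)‖ = 2 * √(7:ℕ) := iL_norm _ _ (by decide)
  rw [l0, l1, l2, l3, l4, l5, l6, l7, l8, l9, l10, l11, l12, l13, l14, l15, l16, l17, l18, l19, l20, l21, l22, l23]
  have hm' : (m : ℝ) = 2 * X + 2 * Y - L - M := by
    have : (m : ℝ) + L + M = 2 * X + 2 * Y := by exact_mod_cast hm
    linarith
  rw [hm', hk, hG]
  simp only [mults]
  push_cast
  rw [Real.sqrt_one]
  ring

theorem hh_formula (s r : ℕ) (hr : r < 6) : hh (6 * s + r) = 3 * (s * s) + 3 * s + 1 + r * s + (r * r + 6 * r) / 12 := by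
  have e : (6 * s + r) ^ 2 + 6 * (6 * s + r) + 12 = 12 * (3 * (s * s) + 3 * s + 1 + r * s) + (r * r + 6 * r) := by ring
  rw [hh, e, Nat.mul_add_div (by norm_num)]

theorem hh_inc (m : ℕ) : hh (m + 1) = hh m + m / 6 + (if m % 6 = 0 then 0 else if m % 6 = 5 then 2 else 1) := by
  obtain ⟨s, r, hr, rfl⟩ : ∃ s r, r < 6 ∧ m = 6 * s + r := ⟨m / 6, m % 6, by omega, by omega⟩
  have e1 : (6 * s + r) / 6 = s := by omega
  have e2 : (6 * s + r) % 6 = r := by omega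
  rw [e1, e2, hh_formula s r hr]
  rcases Nat.lt_or_ge r 5 with h | h
  · rw [add_assoc, hh_formula s (r + 1) (by omega)]
    interval_cases r <;> norm_num <;> ring
  · have : r = 5 := by omega
    subst this
    have := hh_formula (s + 1) 0 (by norm_num)
    rw [show 6 * s + 5 + 1 = 6 * (s + 1) + 0 by ring, this]
    norm_num; ring

theorem bal_inc (k : ℕ) : bal (k + 1) = bal k + k / 6 + 1 := by
  obtain ⟨s, r, hr, rfl⟩ : ∃ s r, r < 6 ∧ k = 6 * s + r := ⟨k / 6, k % 6, by omega, by omega⟩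
  have e1 : (6 * s + r) / 6 = s := by omega
  have e2 : (6 * s + r) % 6 = r := by omega
  rw [bal, bal, e1, e2]
  rcases Nat.lt_or_ge r 5 with h | h
  · have e3 : (6 * s + r + 1) / 6 = s := by omega
    have e4 : (6 * s + r + 1) % 6 = r + 1 := by omega
    rw [e3, e4]; ring
  · have e3 : (6 * s + r + 1) / 6 = s + 1 := by omega
    have e4 : (6 * s + r + 1) % 6 = 0 := by omega
    have : r = 5 := by omega
    rw [e3, e4, this]; ring

theorem bal_mono : Monotone bal := monotone_nat_of_le_succ fun k => by rw [bal_inc]; omega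

theorem hh_mono : Monotone hh := monotone_nat_of_le_succ fun k => by rw [hh_inc]; omega

theorem hexagon (m : ℕ) (hm : 6 ≤ m) : ∃ X Y L M : ℕ,
    2 * hh m + L * (L + 1) + M * (M + 1) = 2 * ((X + 1) * (Y + 1)) ∧ m + L + M = 2 * X + 2 * Y ∧
    m / 6 ≤ L + 1 ∧ m / 6 ≤ M + 1 ∧ m / 6 + L ≤ X + 1 ∧ m / 6 + M ≤ X + 1 ∧ m / 6 + L ≤ Y + 1 ∧ m / 6 + M ≤ Y + 1 := by
  obtain ⟨s, r, hr, rfl⟩ : ∃ s r, r < 6 ∧ m = 6 * (s + 1) + r := ⟨m / 6 - 1, m % 6, by omega, by omega⟩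
  have e1 : (6 * (s + 1) + r) / 6 = s + 1 := by omega
  rw [e1, hh_formula _ r hr]
  interval_cases r
  · exact ⟨2 * s + 2, 2 * s + 2, s + 1, s + 1, by norm_num; ring, by omega, by omega, by omega, by omega, by omega, by omega, by omega⟩
  · exact ⟨2 * s + 2, 2 * s + 2, s + 1, s, by norm_num; ring, by omega, by omega, by omega, by omega, by omega, by omega, by omega⟩
  · exact ⟨2 * s + 3, 2 * s + 2, s + 1, s + 1, by norm_num; ring, by omega, by omega, by omega, by omega, by omega, by omega, by omega⟩
  · exact ⟨2 * s + 3, 2 * s + 3, s + 2, s + 1, by norm_num; ring, by omega, by omega, by omega, by omega, by omega, by omega, by omega⟩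
  · exact ⟨2 * s + 3, 2 * s + 3, s + 1, s + 1, by norm_num; ring, by omega, by omega, by omega, by omega, by omega, by omega, by omega⟩
  · exact ⟨2 * s + 4, 2 * s + 3, s + 2, s + 1, by norm_num; ring, by omega, by omega, by omega, by omega, by omega, by omega, by omega⟩

theorem balanced (k : ℕ) : ∃ c1 c3 c5 c7 c9 c11 : ℕ, k = c1 + c3 + c5 + c7 + c9 + c11 ∧
    c1 * (c1 + 1) + c3 * (c3 + 1) + c5 * (c5 + 1) + c7 * (c7 + 1) + c9 * (c9 + 1) + c11 * (c11 + 1) = 2 * bal k ∧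
    (k / 6 ≤ c1 ∧ k / 6 ≤ c3 ∧ k / 6 ≤ c5 ∧ k / 6 ≤ c7 ∧ k / 6 ≤ c9 ∧ k / 6 ≤ c11) ∧
    (c1 ≤ (k + 5) / 6 ∧ c3 ≤ (k + 5) / 6 ∧ c5 ≤ (k + 5) / 6 ∧ c7 ≤ (k + 5) / 6 ∧ c9 ≤ (k + 5) / 6 ∧ c11 ≤ (k + 5) / 6) := by
  obtain ⟨q, r, hr, rfl⟩ : ∃ s r, r < 6 ∧ k = 6 * s + r := ⟨k / 6, k % 6, by omega, by omega⟩
  have e1 : (6 * q + r) / 6 = q := by omega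
  have e2 : (6 * q + r) % 6 = r := by omega
  rw [bal, e1, e2]
  interval_cases r
  · exact ⟨q, q, q, q, q, q, by ring, by ring, by omega, by omega⟩
  · exact ⟨q + 1, q, q, q, q, q, by ring, by ring, by omega, by omega⟩
  · exact ⟨q + 1, q + 1, q, q, q, q, by ring, by ring, by omega, by omega⟩
  · exact ⟨q + 1, q + 1, q + 1, q, q, q, by ring, by ring, by omega, by omega⟩
  · exact ⟨q + 1, q + 1, q + 1, q + 1, q, q, by ring, by ring, by omega, by omega⟩
  · exact ⟨q + 1, q + 1, q + 1, q + 1, q + 1, q, by ring, by ring, by omega, by omega⟩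

theorem s3lo : (1.73205 : ℝ) < √3 := by rw [Real.lt_sqrt] <;> norm_num
theorem s3hi : √3 < (1.73206 : ℝ) := by rw [Real.sqrt_lt'] <;> norm_num
theorem s7hi : √7 < (2.64576 : ℝ) := by rw [Real.sqrt_lt'] <;> norm_num

theorem step_A (n m k : ℕ) (hn : 371 ≤ n) (hm : 67 ≤ m) (hk : 12 ≤ k) (h : n + bal k ≤ hh m)
    (hC : hh (m - 1) + bal k < hh m + bal (k - 3)) :
    ∃ c' : Fin n → Pl, Packing c' ∧ Wd c' < 2 * (m - (2 - √3) * k) := by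
  obtain ⟨X, Y, L, M, hX, hper, b1, b2, b3, b4, b5, b6⟩ := hexagon (m + 1) (by omega)
  obtain ⟨c1, c3, c5, c7, c9, c11, hks, hcs, ⟨l1, l3, l5, l7, l9, l11⟩, ⟨u1, u3, u5, u7, u9, u11⟩⟩ := balanced k
  have i1 := hh_inc m
  have i2 := hh_inc (m - 1)
  have i3 := bal_inc (k - 1)
  have i4 := bal_inc (k - 2)
  have i5 := bal_inc (k - 3)
  rw [show m - 1 + 1 = m by omega] at i2
  rw [show k - 1 + 1 = k by omega] at i3
  rw [show k - 2 + 1 = k - 1 by omega] at i4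
  rw [show k - 3 + 1 = k - 2 by omega] at i5
  have j1 : hh m + 12 ≤ hh (m + 1) := by
    split_ifs at i1 <;> omega
  have key : 2 * ((k + 5) / 6) + 3 ≤ (m + 1) / 6 := by
    have : 3 + (k - 1) / 6 + (k - 2) / 6 + (k - 3) / 6 < (m - 1) / 6 + (if (m - 1) % 6 = 0 then 0 else if (m - 1) % 6 = 5 then 2 else 1) := by omega
    split_ifs at this <;> omega
  have k2 : 2 ≤ k / 6 := by omega
  clear i1 i2 i3 i4 i5
  obtain ⟨c', hp, hw⟩ := polygon n (by omega) X Y L M c1 c3 c5 c7 c9 c11 1 1 1 1 1 1 1 1 1 1 1 1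
    le_rfl le_rfl le_rfl le_rfl le_rfl le_rfl le_rfl le_rfl le_rfl le_rfl le_rfl le_rfl
    (by omega) (by omega) (by omega) (by omega) (by omega) (by omega) (by omega) (by omega)
    (by omega) (by omega) (by omega) (by omega) (m + 1) k 12 hper hks rfl (by linarith)
  refine ⟨c', hp, hw.trans_lt ?_⟩
  push_cast
  linarith [s3lo, s7hi]

theorem step_66 (n k : ℕ) (hn : 371 ≤ n) (hk : 12 ≤ k) (h : n + bal k ≤ hh 66) :
    ∃ c' : Fin n → Pl, Packing c' ∧ Wd c' < 2 * ((66 : ℕ) - (2 - √3) * k) := by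
  have h66 : hh 66 = 397 := by norm_num [hh]
  have hk15 : k < 15 := by
    by_contra hc
    have h1 := bal_mono (not_lt.1 hc)
    have h2 : bal 15 = 27 := by norm_num [bal]
    omega
  have d12 : bal 12 = 18 := by norm_num [bal]
  have d13 : bal 13 = 21 := by norm_num [bal]
  have d14 : bal 14 = 24 := by norm_num [bal]
  interval_cases k
  · obtain ⟨c', hp, hw⟩ := polygon n (by omega) 23 22 11 11 3 3 3 3 3 3 1 1 1 1 1 0 0 0 0 0 0 0
      (by norm_num) (by norm_num) (by norm_num) (by norm_num) (by norm_num) (by norm_num)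
      (by norm_num) (by norm_num) (by norm_num) (by norm_num) (by norm_num) (by norm_num)
      (by norm_num) (by norm_num) (by norm_num) (by norm_num) (by norm_num) (by norm_num)
      (by norm_num) (by norm_num) (by norm_num) (by norm_num) (by norm_num) (by norm_num)
      68 18 5 (by norm_num) (by norm_num) (by norm_num) (by omega)
    refine ⟨c', hp, hw.trans_lt ?_⟩
    push_cast
    linarith [s3lo, s7hi, s3hi]
  · obtain ⟨c', hp, hw⟩ := polygon n (by omega) 23 22 11 11 3 3 3 3 3 3 1 1 1 1 1 1 1 1 0 0 0 0
      (by norm_num) (by norm_num) (by norm_num) (by norm_num) (by norm_num) (by norm_num)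
      (by norm_num) (by norm_num) (by norm_num) (by norm_num) (by norm_num) (by norm_num)
      (by norm_num) (by norm_num) (by norm_num) (by norm_num) (by norm_num) (by norm_num)
      (by norm_num) (by norm_num) (by norm_num) (by norm_num) (by norm_num) (by norm_num)
      68 18 8 (by norm_num) (by norm_num) (by norm_num) (by omega)
    refine ⟨c', hp, hw.trans_lt ?_⟩
    push_cast
    linarith [s3lo, s7hi, s3hi]
  · obtain ⟨c', hp, hw⟩ := polygon n (by omega) 23 22 11 11 3 3 3 3 3 3 1 1 1 1 1 1 1 1 1 1 1 0
      (by norm_num) (by norm_num) (by norm_num) (by norm_num) (by norm_num) (by norm_num)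
      (by norm_num) (by norm_num) (by norm_num) (by norm_num) (by norm_num) (by norm_num)
      (by norm_num) (by norm_num) (by norm_num) (by norm_num) (by norm_num) (by norm_num)
      (by norm_num) (by norm_num) (by norm_num) (by norm_num) (by norm_num) (by norm_num)
      68 18 11 (by norm_num) (by norm_num) (by norm_num) (by omega)
    refine ⟨c', hp, hw.trans_lt ?_⟩
    push_cast
    linarith [s3lo, s7hi, s3hi]

theorem chain_ge (n : ℕ) (hn : 371 ≤ n) (k : ℕ) : ∀ m, 12 ≤ k → n + bal k ≤ hh m →
    ∃ c' : Fin n → Pl, Packing c' ∧ Wd c' < 2 * (m - (2 - √3) * k) := by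
  induction k using Nat.strong_induction_on with
  | _ k ih =>
    intro m hk h
    have hb := bal_mono hk
    have d12 : bal 12 = 18 := by norm_num [bal]
    have h65 : hh 65 = 385 := by norm_num [hh]
    have hm : 66 ≤ m := by
      by_contra hc
      have := hh_mono (show m ≤ 65 by omega)
      omega
    rcases Nat.eq_or_lt_of_le hm with h66 | h67
    · subst h66; exact step_66 n k hn hk h
    by_cases hC : hh (m - 1) + bal k < hh m + bal (k - 3)
    · exact step_A n m k hn h67 hk h hC
    have i2 := hh_inc (m - 1)
    have i3 := bal_inc (k - 1)
    have i4 := bal_inc (k - 2)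
    have i5 := bal_inc (k - 3)
    rw [show m - 1 + 1 = m by omega] at i2
    rw [show k - 1 + 1 = k by omega] at i3
    rw [show k - 2 + 1 = k - 1 by omega] at i4
    rw [show k - 3 + 1 = k - 2 by omega] at i5
    have hk15 : 15 ≤ k := by split_ifs at i2 <;> omega
    obtain ⟨c', hp, hw⟩ := ih (k - 3) (by omega) (m - 1) (by omega) (by omega)
    refine ⟨c', hp, hw.trans ?_⟩
    rw [Nat.cast_sub (by omega), Nat.cast_sub (by omega)]
    push_cast
    linarith [s3lo]

theorem chain_all (n : ℕ) (hn : 371 ≤ n) (j : ℕ) : ∀ m k, 12 ≤ k + j → n + bal k ≤ hh m →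
    ∃ c' : Fin n → Pl, Packing c' ∧ Wd c' < 2 * (m - (2 - √3) * k) := by
  induction j with
  | zero => intro m k hk h; exact chain_ge n hn k m (by omega) h
  | succ j ih =>
    intro m k hk h
    rcases Nat.lt_or_ge k 12 with hk12 | hk12
    · have h63 : hh 63 = 363 := by norm_num [hh]
      have hm : 64 ≤ m := by
        by_contra hc
        have := hh_mono (show m ≤ 63 by omega)
        omega
      have i1 := hh_inc m
      have i3 := bal_inc k
      have i4 := bal_inc (k + 1)
      have i5 := bal_inc (k + 2)
      have i6 := bal_inc (k + 3)
      simp only [add_assoc, Nat.reduceAdd] at i3 i4 i5 i6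
      obtain ⟨c', hp, hw⟩ := ih (m + 1) (k + 4) (by omega) (by split_ifs at i1 <;> omega)
      refine ⟨c', hp, hw.trans ?_⟩
      push_cast
      linarith [s3hi]
    · exact chain_ge n hn k m hk12 h

theorem main_step (n : ℕ) (hn : 371 ≤ n) (z : Fin n → ℤ × ℤ) (hz : Function.Injective z) :
    ∃ c' : Fin n → Pl, Packing c' ∧ Wd c' < Wd fun i => iL (z i) := by
  by_contra hno
  have : Nonempty (Fin n) := ⟨⟨0, by omega⟩⟩
  obtain ⟨m, k, h, hW⟩ := case_split n z hz hno
  obtain ⟨c', hp, hw⟩ := chain_all n hn 12 m k (by omega) h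
  exact hno ⟨c', hp, hw.trans_le hW⟩

/-- For `n ≥ 371` there exists `λ₀ = λ₀(n) > 0` such that for every `λ > λ₀`, any packing of
`n` unit disks in `E²` minimizing the area of its outer parallel domain of outer radius `λ`
is not (up to an isometry of the plane) a subfamily of the densest lattice packing of unit
disks. -/
theorem min_parallel_domain_not_hexagonal (n : ℕ) (hn : 371 ≤ n) :
    ∃ lam0 : ℝ, 0 < lam0 ∧ ∀ lam : ℝ, lam0 < lam →
      ∀ c : Fin n → EuclideanSpace ℝ (Fin 2),
        (∀ j k : Fin n, j ≠ k → 2 ≤ ‖c j - c k‖) →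
        (∀ c' : Fin n → EuclideanSpace ℝ (Fin 2),
          (∀ j k : Fin n, j ≠ k → 2 ≤ ‖c' j - c' k‖) →
          volume (⋃ i : Fin n, closedBall (c i) (1 + lam)) ≤
            volume (⋃ i : Fin n, closedBall (c' i) (1 + lam))) →
        ¬ ∃ φ : EuclideanSpace ℝ (Fin 2) ≃ᵢ EuclideanSpace ℝ (Fin 2),
            ∀ i : Fin n, φ (c i) ∈ hexLattice := by
  exact reduction n (by omega) (fun z hz => main_step n hn z hz)
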